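/- arXiv:1403.7106 — 2 statements merged into one kernel-verified Lean document; each statement's English description precedes it below -/
import Mathlib

section
/- (Lemma on infima and suprema of super-sub solutions.) Let the system F_j(x,u(x),Du_j(x),D²u_j(x)) = 0, j = 1,…,m₁+m₂, be degenerate elliptic and balanced quasi-monotone. Let S be a nonempty set of super-sub solutions of the system that is uniformly bounded (i.e., there is M with |v(x)| ≤ M for all v ∈ S and x ∈ Ω). Define u_{1j}(x) = inf{v_{1j}(x) : (v₁,v₂) ∈ S} for 1 ≤ j ≤ m₁ and u_{2j}(x) = sup{v_{2j}(x) : (v₁,v₂) ∈ S} for 1 ≤ j ≤ m₂. If u_{1j*}(x) > −∞ for all x ∈ Ω and 1 ≤ j ≤ m₁, and u_{2j}*(x) < ∞ for all x ∈ Ω and 1 ≤ j ≤ m₂, then (u₁,u₂) is a super-sub solution of the system. -/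
open Filter Topology Matrix Bornology

noncomputable section

/-- Euclidean space ℝⁿ. -/
abbrev En (n : ℕ) := EuclideanSpace ℝ (Fin n)

/-- n×n real matrices (the symmetric ones model 𝒮ⁿ). -/
abbrev Symn (n : ℕ) := Matrix (Fin n) (Fin n) ℝ

/-- Loewner order: `X ≤ Y` iff `Y - X` is positive semidefinite. -/
def LoewnerLE {ι : Type*} [Fintype ι] (X Y : Matrix ι ι ℝ) : Prop := (Y - X).PosSemidef

/-- Upper semicontinuous envelope relative to Ω: f*(x) = limsup_{Ω ∋ y → x} f(y). -/
def uEnv {n : ℕ} (Ω : Set (En n)) (f : En n → ℝ) (x : En n) : ℝ := limsup f (𝓝[Ω] x)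

/-- Lower semicontinuous envelope relative to Ω: f_*(x) = liminf_{Ω ∋ y → x} f(y). -/
def lEnv {n : ℕ} (Ω : Set (En n)) (f : En n → ℝ) (x : En n) : ℝ := liminf f (𝓝[Ω] x)

/-- φ touches f from above at x (within Ω). -/
def TouchAbove {n : ℕ} (Ω : Set (En n)) (φ f : En n → ℝ) (x : En n) : Prop :=
  φ x = f x ∧ ∃ N : Set (En n), IsOpen N ∧ x ∈ N ∧ ∀ y ∈ (N ∩ Ω) \ {x}, f y < φ y

/-- φ touches f from below at x (within Ω). -/
def TouchBelow {n : ℕ} (Ω : Set (En n)) (φ f : En n → ℝ) (x : En n) : Prop :=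
  φ x = f x ∧ ∃ N : Set (En n), IsOpen N ∧ x ∈ N ∧ ∀ y ∈ (N ∩ Ω) \ {x}, φ y < f y

/-- Hessian matrix D²φ(x) of a scalar function. -/
def hess {n : ℕ} (φ : En n → ℝ) (x : En n) : Symn n :=
  Matrix.of fun i j =>
    iteratedFDeriv ℝ 2 φ x ![EuclideanSpace.single i 1, EuclideanSpace.single j 1]

/-- The type of the operators F_j(x, r, s, p, X). -/
abbrev Op (n m₁ m₂ : ℕ) :=
  En n → (Fin m₁ → ℝ) → (Fin m₂ → ℝ) → En n → Symn n → ℝ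

/-- Continuity of an operator on Ω × ℝ^{m₁} × ℝ^{m₂} × ℝⁿ × 𝒮ⁿ. -/
def OpContinuousOn {n m₁ m₂ : ℕ} (Ω : Set (En n)) (F : Op n m₁ m₂) : Prop :=
  ContinuousOn (fun q : En n × (Fin m₁ → ℝ) × (Fin m₂ → ℝ) × En n × Symn n =>
      F q.1 q.2.1 q.2.2.1 q.2.2.2.1 q.2.2.2.2)
    (Ω ×ˢ (Set.univ : Set ((Fin m₁ → ℝ) × (Fin m₂ → ℝ) × En n × Symn n)))

/-- Degenerate ellipticity of an operator. -/
def DegElliptic {n m₁ m₂ : ℕ} (Ω : Set (En n)) (F : Op n m₁ m₂) : Prop :=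
  ∀ x ∈ Ω, ∀ (r : Fin m₁ → ℝ) (s : Fin m₂ → ℝ) (p : En n) (X Y : Symn n),
    X.IsSymm → Y.IsSymm → LoewnerLE X Y → F x r s p Y ≤ F x r s p X

/-- Balanced quasi-monotonicity of the system (F1, F2). -/
def BalancedQM {n m₁ m₂ : ℕ} (Ω : Set (En n))
    (F1 : Fin m₁ → Op n m₁ m₂) (F2 : Fin m₂ → Op n m₁ m₂) : Prop :=
  (∀ j, ∀ x ∈ Ω, ∀ (r : Fin m₁ → ℝ) (s σ : Fin m₂ → ℝ) (p : En n) (X : Symn n), X.IsSymm →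
      (∀ i, s i ≤ σ i) → F1 j x r s p X ≤ F1 j x r σ p X) ∧
  (∀ j, ∀ x ∈ Ω, ∀ (r ρ : Fin m₁ → ℝ) (s : Fin m₂ → ℝ) (p : En n) (X : Symn n), X.IsSymm →
      (∀ i, r i ≤ ρ i) → r j = ρ j → F1 j x ρ s p X ≤ F1 j x r s p X) ∧
  (∀ j, ∀ x ∈ Ω, ∀ (r ρ : Fin m₁ → ℝ) (s : Fin m₂ → ℝ) (p : En n) (X : Symn n), X.IsSymm →
      (∀ i, r i ≤ ρ i) → F2 j x r s p X ≤ F2 j x ρ s p X) ∧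
  (∀ j, ∀ x ∈ Ω, ∀ (r : Fin m₁ → ℝ) (s σ : Fin m₂ → ℝ) (p : En n) (X : Symn n), X.IsSymm →
      (∀ i, s i ≤ σ i) → s j = σ j → F2 j x r σ p X ≤ F2 j x r s p X)

/-- Boundedness of a vector-valued function on Ω. -/
def BddOn {n m : ℕ} (Ω : Set (En n)) (u : En n → Fin m → ℝ) : Prop :=
  ∃ M : ℝ, ∀ x ∈ Ω, ∀ i, |u x i| ≤ M

/-- (u1, u2) is a super-sub solution of the system (F1, F2) in Ω. -/
def SuperSub {n m₁ m₂ : ℕ} (Ω : Set (En n))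
    (F1 : Fin m₁ → Op n m₁ m₂) (F2 : Fin m₂ → Op n m₁ m₂)
    (u1 : En n → Fin m₁ → ℝ) (u2 : En n → Fin m₂ → ℝ) : Prop :=
  BddOn Ω u1 ∧ BddOn Ω u2 ∧
  (∀ j, ∀ x ∈ Ω, ∀ φ : En n → ℝ, ContDiff ℝ 2 φ →
      TouchBelow Ω φ (lEnv Ω fun y => u1 y j) x →
      0 ≤ F1 j x (fun i => lEnv Ω (fun y => u1 y i) x) (fun i => uEnv Ω (fun y => u2 y i) x)
            (gradient φ x) (hess φ x)) ∧
  (∀ j, ∀ x ∈ Ω, ∀ φ : En n → ℝ, ContDiff ℝ 2 φ →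
      TouchAbove Ω φ (uEnv Ω fun y => u2 y j) x →
      F2 j x (fun i => lEnv Ω (fun y => u1 y i) x) (fun i => uEnv Ω (fun y => u2 y i) x)
          (gradient φ x) (hess φ x) ≤ 0)

/-- (u1, u2) is a sub-super solution of the system (F1, F2) in Ω. -/
def SubSuper {n m₁ m₂ : ℕ} (Ω : Set (En n))
    (F1 : Fin m₁ → Op n m₁ m₂) (F2 : Fin m₂ → Op n m₁ m₂)
    (u1 : En n → Fin m₁ → ℝ) (u2 : En n → Fin m₂ → ℝ) : Prop :=
  BddOn Ω u1 ∧ BddOn Ω u2 ∧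
  (∀ j, ∀ x ∈ Ω, ∀ φ : En n → ℝ, ContDiff ℝ 2 φ →
      TouchAbove Ω φ (uEnv Ω fun y => u1 y j) x →
      F1 j x (fun i => uEnv Ω (fun y => u1 y i) x) (fun i => lEnv Ω (fun y => u2 y i) x)
          (gradient φ x) (hess φ x) ≤ 0) ∧
  (∀ j, ∀ x ∈ Ω, ∀ φ : En n → ℝ, ContDiff ℝ 2 φ →
      TouchBelow Ω φ (lEnv Ω fun y => u2 y j) x →
      0 ≤ F2 j x (fun i => uEnv Ω (fun y => u1 y i) x) (fun i => lEnv Ω (fun y => u2 y i) x)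
            (gradient φ x) (hess φ x))

section Envelope

variable {n : ℕ} {Ω : Set (En n)} {f g : En n → ℝ} {M : ℝ} {x : En n}

lemma isBoundedUnder_ge_nhdsWithin (hf : ∀ y ∈ Ω, |f y| ≤ M) (x : En n) :
    IsBoundedUnder (· ≥ ·) (𝓝[Ω] x) f :=
  ⟨-M, eventually_map.2 <| eventually_mem_nhdsWithin.mono fun y hy => (abs_le.1 (hf y hy)).1⟩

lemma isCoboundedUnder_ge_nhdsWithin (hf : ∀ y ∈ Ω, |f y| ≤ M) (hx : x ∈ Ω) :
    IsCoboundedUnder (· ≥ ·) (𝓝[Ω] x) f :=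
  haveI : (𝓝[Ω] x).NeBot := mem_closure_iff_nhdsWithin_neBot.1 (subset_closure hx)
  IsBoundedUnder.isCoboundedUnder_ge
    ⟨M, eventually_map.2 <| eventually_mem_nhdsWithin.mono fun y hy => (abs_le.1 (hf y hy)).2⟩

lemma lEnv_le (hf : ∀ y ∈ Ω, |f y| ≤ M) (hx : x ∈ Ω) : lEnv Ω f x ≤ f x := by
  refine liminf_le_of_frequently_le (fun h => ?_) (isBoundedUnder_ge_nhdsWithin hf x)
  exact h.self_of_nhdsWithin hx le_rfl

lemma lEnv_mono (hf : ∀ y ∈ Ω, |f y| ≤ M) (hg : ∀ y ∈ Ω, |g y| ≤ M) (hfg : ∀ y ∈ Ω, f y ≤ g y)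
    (hx : x ∈ Ω) : lEnv Ω f x ≤ lEnv Ω g x :=
  liminf_le_liminf (eventually_mem_nhdsWithin.mono hfg)
    (isBoundedUnder_ge_nhdsWithin hf x) (isCoboundedUnder_ge_nhdsWithin hg hx)

lemma lowerSemicontinuousOn_lEnv (hf : ∀ y ∈ Ω, |f y| ≤ M) :
    LowerSemicontinuousOn (lEnv Ω f) Ω := by
  intro x hx a ha
  obtain ⟨b, hab, hb⟩ := exists_between ha
  have h := eventually_lt_of_lt_liminf hb (isBoundedUnder_ge_nhdsWithin hf x)
  filter_upwards [eventually_eventually_nhdsWithin.2 h, eventually_mem_nhdsWithin] with y hy hyΩ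
  exact hab.trans_le (le_liminf_of_le (isCoboundedUnder_ge_nhdsWithin hf hyΩ)
    (hy.mono fun _ => le_of_lt))

lemma uEnv_eq_neg_lEnv_neg (Ω : Set (En n)) (f : En n → ℝ) (x : En n) :
    uEnv Ω f x = -lEnv Ω (fun y => -f y) x := by
  rw [uEnv, lEnv, limsup_eq, liminf_eq, Real.sInf_def]
  congr 2
  ext a
  simp [le_neg]

lemma uEnv_mono (hf : ∀ y ∈ Ω, |f y| ≤ M) (hg : ∀ y ∈ Ω, |g y| ≤ M) (hfg : ∀ y ∈ Ω, f y ≤ g y)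
    (hx : x ∈ Ω) : uEnv Ω f x ≤ uEnv Ω g x := by
  simp only [uEnv_eq_neg_lEnv_neg, neg_le_neg_iff]
  exact lEnv_mono (by simpa using hg) (by simpa using hf) (by simpa using hfg) hx

end Envelope

section Derivatives

variable {n : ℕ} {φ : En n → ℝ}

lemma gradient_eq_of_fderiv_eq {φ ψ : En n → ℝ} {x : En n} (h : fderiv ℝ φ x = fderiv ℝ ψ x) :
    gradient φ x = gradient ψ x := by
  simp only [gradient, h]

lemma continuous_gradient (hφ : ContDiff ℝ 2 φ) : Continuous (gradient φ) :=
  (InnerProductSpace.toDual ℝ (En n)).symm.continuous.comp (hφ.continuous_fderiv (by norm_num))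

lemma continuous_hess (hφ : ContDiff ℝ 2 φ) : Continuous (hess φ) := by
  have h : Continuous fun x => iteratedFDeriv ℝ 2 φ x :=
    hφ.continuous_iteratedFDeriv (by norm_num)
  refine continuous_pi fun i => continuous_pi fun j => ?_
  exact (ContinuousMultilinearMap.apply ℝ (fun _ : Fin 2 => En n) ℝ _).continuous.comp h

lemma hess_isSymm (hφ : ContDiff ℝ 2 φ) (x : En n) : (hess φ x).IsSymm := by
  ext i j
  have h : IsSymmSndFDerivAt ℝ φ x := hφ.contDiffAt.isSymmSndFDerivAt (by simp)
  simpa [hess, iteratedFDeriv_two_apply] using h _ _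

lemma gradient_neg (φ : En n → ℝ) (x : En n) : gradient (fun y => -φ y) x = -gradient φ x := by
  simp [gradient, fderiv_fun_neg]

lemma hess_neg (φ : En n → ℝ) (x : En n) : hess (fun y => -φ y) x = -hess φ x := by
  ext i j
  have : (fun y => -φ y) = -φ := rfl
  simp [hess, this, iteratedFDeriv_neg_apply]

lemma hasFDerivAt_quartic (z y : En n) :
    HasFDerivAt (fun y : En n => (‖y - z‖ ^ 2) ^ 2)
      ((2 * ‖y - z‖ ^ 2) • ((2 : ℝ) • innerSL ℝ (y - z))) y := by
  have h := (((hasFDerivAt_id (𝕜 := ℝ) y).sub_const z).norm_sq).pow 2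
  refine h.congr_fderiv ?_
  ext w
  simp

lemma fderiv_fderiv_quartic (z : En n) :
    fderiv ℝ (fderiv ℝ fun y : En n => (‖y - z‖ ^ 2) ^ 2) z = 0 := by
  have h : (fderiv ℝ fun y : En n => (‖y - z‖ ^ 2) ^ 2) =
      (fun y => 2 * ‖y - z‖ ^ 2) • fun y => (2 : ℝ) • innerSL ℝ (y - z) :=
    funext fun y => (hasFDerivAt_quartic z y).fderiv
  have h1 : HasFDerivAt (fun y : En n => 2 * ‖y - z‖ ^ 2) _ z :=
    (((hasFDerivAt_id z).sub_const z).norm_sq).const_mul 2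
  have h2 : HasFDerivAt (fun y : En n => (2 : ℝ) • innerSL ℝ (y - z)) ((2 : ℝ) • innerSL ℝ) z :=
    ((innerSL ℝ).hasFDerivAt.comp z ((hasFDerivAt_id z).sub_const z)).const_smul (2 : ℝ)
  rw [h, (HasFDerivAt.smul h1 h2).fderiv]
  simp

lemma contDiff_quartic (z : En n) : ContDiff ℝ 2 fun y : En n => (‖y - z‖ ^ 2) ^ 2 :=
  ((contDiff_id.sub contDiff_const).norm_sq ℝ).pow 2

/-- A `C²` function can be modified to a function lying strictly below it off `z`,
without changing its derivatives of order one and two at `z`. -/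
lemma exists_strictly_below (hφ : ContDiff ℝ 2 φ) (z : En n) (c : ℝ) :
    ∃ ψ : En n → ℝ, ContDiff ℝ 2 ψ ∧ ψ z = φ z + c ∧ (∀ y, y ≠ z → ψ y < φ y + c) ∧
      gradient ψ z = gradient φ z ∧ hess ψ z = hess φ z := by
  have hq := contDiff_quartic z
  refine ⟨fun y => (φ y - (‖y - z‖ ^ 2) ^ 2) + c, (hφ.sub hq).add contDiff_const, by simp,
    fun y hy => ?_, gradient_eq_of_fderiv_eq ?_, ?_⟩
  · have : 0 < ‖y - z‖ := norm_pos_iff.2 (sub_ne_zero.2 hy)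
    have : 0 < (‖y - z‖ ^ 2) ^ 2 := by positivity
    linarith
  · rw [fderiv_add_const, fderiv_fun_sub (hφ.differentiable (by norm_num) z)
      (hasFDerivAt_quartic z z).differentiableAt, (hasFDerivAt_quartic z z).fderiv]
    simp
  · have h : fderiv ℝ (fun y => (φ y - (‖y - z‖ ^ 2) ^ 2) + c) =
        fun y => fderiv ℝ φ y - fderiv ℝ (fun y : En n => (‖y - z‖ ^ 2) ^ 2) y := by
      ext1 y
      rw [fderiv_add_const, fderiv_fun_sub (hφ.differentiable (by norm_num) y)
        (hasFDerivAt_quartic z y).differentiableAt]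
    ext i j
    simp only [hess, Matrix.of_apply, iteratedFDeriv_two_apply, h]
    rw [fderiv_fun_sub, fderiv_fderiv_quartic, sub_zero]
    · exact ((hφ.fderiv_right (m := 1) (by norm_num)).differentiable (by norm_num)) z
    · exact ((hq.fderiv_right (m := 1) (by norm_num)).differentiable (by norm_num)) z

end Derivatives

/-- If `φ` touches the lower envelope of an infimum from below at `x`, then near `x` some member
of the family is touched from below by a function with the same derivatives as `φ`. -/
lemma exists_touchBelow_near {n : ℕ} {ι : Type*} {Ω : Set (En n)} (hΩ : IsOpen Ω) {M : ℝ}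
    {f : En n → ℝ} {v : ι → En n → ℝ} (hf : ∀ y ∈ Ω, |f y| ≤ M) (hv : ∀ i, ∀ y ∈ Ω, |v i y| ≤ M)
    (hfv : ∀ y ∈ Ω, IsGLB (Set.range fun i => v i y) (f y))
    {φ : En n → ℝ} (hφ : ContDiff ℝ 2 φ) {x : En n} (hx : x ∈ Ω)
    (ht : TouchBelow Ω φ (lEnv Ω f) x) {δ : ℝ} (hδ : 0 < δ) :
    ∃ i, ∃ z ∈ Ω, dist z x < δ ∧ |lEnv Ω (v i) z - lEnv Ω f x| < δ ∧
      ∃ ψ : En n → ℝ, ContDiff ℝ 2 ψ ∧ TouchBelow Ω ψ (lEnv Ω (v i)) z ∧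
        gradient ψ z = gradient φ z ∧ hess ψ z = hess φ z := by
  obtain ⟨htx, N, hN, hxN, hlt⟩ := ht
  have hφc : Continuous φ := hφ.continuous
  have hφx : ∀ ε > 0, ∀ᶠ y in 𝓝 x, |φ y - φ x| < ε := Metric.tendsto_nhds.1 (hφc.tendsto x)
  have hnhds : ∀ᶠ y in 𝓝 x, y ∈ N ∩ Ω ∧ |φ y - φ x| < δ / 2 :=
    ((hN.inter hΩ).eventually_mem ⟨hxN, hx⟩).and (hφx _ (half_pos hδ))
  obtain ⟨ε, hε, hball⟩ := Metric.nhds_basis_closedBall.eventually_iff.1 hnhds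
  obtain ⟨ρ, hρ, hρ'⟩ : ∃ ρ, 0 < ρ ∧ ρ < min ε δ := exists_between (lt_min hε hδ)
  have hsub : ∀ y ∈ Metric.closedBall x ρ, y ∈ N ∩ Ω ∧ |φ y - φ x| < δ / 2 := fun y hy =>
    hball (Metric.closedBall_subset_closedBall (hρ'.le.trans (min_le_left _ _)) hy)
  have hlsc : ∀ g : En n → ℝ, (∀ y ∈ Ω, |g y| ≤ M) →
      LowerSemicontinuousOn (fun y => lEnv Ω g y + -φ y) (Metric.closedBall x ρ) := fun g hg =>
    ((lowerSemicontinuousOn_lEnv hg).mono fun y hy => (hsub y hy).1.2).add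
      (hφc.neg.lowerSemicontinuous.lowerSemicontinuousOn _)
  obtain ⟨μ, hμ, hμs⟩ : ∃ μ > 0, ∀ y ∈ Metric.sphere x ρ, μ ≤ lEnv Ω f y + -φ y := by
    rcases (Metric.sphere x ρ).eq_empty_or_nonempty with h | h
    · exact ⟨1, one_pos, by simp [h]⟩
    · obtain ⟨a, ha, hmin⟩ := ((hlsc f hf).mono Metric.sphere_subset_closedBall).exists_isMinOn h
        (isCompact_sphere x ρ)
      refine ⟨_, ?_, fun y hy => hmin hy⟩
      have := hlt a ⟨(hsub a (Metric.sphere_subset_closedBall ha)).1,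
        Metric.ne_of_mem_sphere ha hρ.ne'⟩
      linarith
  set η := min μ (δ / 2) with hη
  have hη0 : 0 < η := lt_min hμ (by positivity)
  obtain ⟨y, hy, hyb, hyφ⟩ : ∃ y, f y < φ x + η / 2 ∧ y ∈ Metric.closedBall x ρ ∧
      |φ y - φ x| < η / 2 := by
    have h1 : ∃ᶠ y in 𝓝[Ω] x, f y < φ x + η / 2 :=
      frequently_lt_of_liminf_lt (isCoboundedUnder_ge_nhdsWithin hf hx)
        (by change lEnv Ω f x < _; linarith)
    have h2 : ∀ᶠ y in 𝓝[Ω] x, y ∈ Metric.closedBall x ρ :=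
      nhdsWithin_le_nhds (Metric.closedBall_mem_nhds x hρ)
    have h3 : ∀ᶠ y in 𝓝[Ω] x, |φ y - φ x| < η / 2 := nhdsWithin_le_nhds (hφx _ (half_pos hη0))
    obtain ⟨y, hy⟩ := (h1.and_eventually (h2.and h3)).exists
    exact ⟨y, hy⟩
  have hyΩ := (hsub y hyb).1.2
  obtain ⟨_, ⟨i, rfl⟩, hi⟩ := (isGLB_lt_iff (hfv y hyΩ)).1 (show f y < φ y + η by
    have := (abs_lt.1 hyφ).1
    linarith)
  obtain ⟨z, hz, hzmin⟩ := (hlsc (v i) (hv i)).exists_isMinOn ⟨y, hyb⟩ (isCompact_closedBall x ρ)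
  have hzΩ := (hsub z hz).1.2
  have hzη : lEnv Ω (v i) z + -φ z < η := by
    have h1 : lEnv Ω (v i) z + -φ z ≤ lEnv Ω (v i) y + -φ y := hzmin hyb
    have h2 := lEnv_le (hv i) hyΩ
    simp only at hi
    linarith
  have hmono : lEnv Ω f z ≤ lEnv Ω (v i) z :=
    lEnv_mono hf (hv i) (fun w hw => (hfv w hw).1 ⟨i, rfl⟩) hzΩ
  have hz0 : φ z ≤ lEnv Ω f z := by
    rcases eq_or_ne z x with rfl | hne
    · exact htx.le
    · exact (hlt z ⟨(hsub z hz).1, hne⟩).le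
  have hzball : z ∈ Metric.ball x ρ := by
    by_contra h
    have := hμs z (le_antisymm hz (not_lt.1 h))
    have := min_le_left μ (δ / 2)
    linarith
  obtain ⟨ψ, hψ, hψz, hψlt, hgrad, hhess⟩ := exists_strictly_below hφ z (lEnv Ω (v i) z - φ z)
  refine ⟨i, z, hzΩ, hzball.trans (hρ'.trans_le (min_le_right _ _)), ?_, ψ, hψ,
    ⟨by linarith, Metric.ball x ρ, Metric.isOpen_ball, hzball, fun w hw => ?_⟩, hgrad, hhess⟩
  · have h1 := abs_lt.1 (hsub z hz).2
    have h2 := min_le_right μ (δ / 2)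
    rw [abs_lt]
    constructor <;> linarith [h1.1, h1.2]
  · have h1 := hψlt w hw.2
    have h2 : lEnv Ω (v i) z + -φ z ≤ lEnv Ω (v i) w + -φ w :=
      hzmin (Metric.ball_subset_closedBall hw.1.1)
    linarith

/-- Stability of the supersolution inequality for one operator under taking infima of the first
and suprema of the second components of a family. -/
lemma supersolution_inf {n m₁ m₂ : ℕ} {ι : Type*} {Ω : Set (En n)} (hΩ : IsOpen Ω)
    {F : Op n m₁ m₂} (j : Fin m₁) (hFc : OpContinuousOn Ω F)
    (hFs : ∀ x ∈ Ω, ∀ (r : Fin m₁ → ℝ) (s σ : Fin m₂ → ℝ) (p : En n) (X : Symn n), X.IsSymm →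
      (∀ i, s i ≤ σ i) → F x r s p X ≤ F x r σ p X)
    (hFr : ∀ x ∈ Ω, ∀ (r ρ : Fin m₁ → ℝ) (s : Fin m₂ → ℝ) (p : En n) (X : Symn n), X.IsSymm →
      (∀ i, r i ≤ ρ i) → r j = ρ j → F x ρ s p X ≤ F x r s p X)
    {v1 : ι → En n → Fin m₁ → ℝ} {v2 : ι → En n → Fin m₂ → ℝ}
    {u1 : En n → Fin m₁ → ℝ} {u2 : En n → Fin m₂ → ℝ} {M : ℝ}
    (hv1 : ∀ i k, ∀ y ∈ Ω, |v1 i y k| ≤ M) (hv2 : ∀ i k, ∀ y ∈ Ω, |v2 i y k| ≤ M)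
    (hu1 : ∀ k, ∀ y ∈ Ω, |u1 y k| ≤ M) (hu2 : ∀ k, ∀ y ∈ Ω, |u2 y k| ≤ M)
    (hglb : ∀ k, ∀ y ∈ Ω, IsGLB (Set.range fun i => v1 i y k) (u1 y k))
    (hlub : ∀ k, ∀ y ∈ Ω, IsLUB (Set.range fun i => v2 i y k) (u2 y k))
    (hsol : ∀ i, ∀ x ∈ Ω, ∀ φ : En n → ℝ, ContDiff ℝ 2 φ →
      TouchBelow Ω φ (lEnv Ω fun y => v1 i y j) x →
      0 ≤ F x (fun k => lEnv Ω (fun y => v1 i y k) x) (fun k => uEnv Ω (fun y => v2 i y k) x)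
        (gradient φ x) (hess φ x))
    {x : En n} (hx : x ∈ Ω) {φ : En n → ℝ} (hφ : ContDiff ℝ 2 φ)
    (ht : TouchBelow Ω φ (lEnv Ω fun y => u1 y j) x) :
    0 ≤ F x (fun k => lEnv Ω (fun y => u1 y k) x) (fun k => uEnv Ω (fun y => u2 y k) x)
      (gradient φ x) (hess φ x) := by
  choose i z hzΩ hzx hvz ψ hψ htψ hgrad hhess using fun k : ℕ =>
    exists_touchBelow_near hΩ (hu1 j) (fun i => hv1 i j) (hglb j) hφ hx ht
      (Nat.one_div_pos_of_nat (α := ℝ) (n := k))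
  have hδ : Tendsto (fun k : ℕ => 1 / ((k : ℝ) + 1)) atTop (𝓝 0) :=
    tendsto_one_div_add_atTop_nhds_zero_nat
  have hz : Tendsto z atTop (𝓝 x) :=
    tendsto_iff_dist_tendsto_zero.2
      (squeeze_zero (fun _ => dist_nonneg) (fun k => (hzx k).le) hδ)
  have hvlim : Tendsto (fun k => lEnv Ω (fun y => v1 (i k) y j) (z k)) atTop
      (𝓝 (lEnv Ω (fun y => u1 y j) x)) :=
    tendsto_iff_dist_tendsto_zero.2
      (squeeze_zero (fun _ => dist_nonneg) (fun k => (hvz k).le) hδ)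
  have hzW : Tendsto z atTop (𝓝[Ω] x) :=
    tendsto_nhdsWithin_iff.2 ⟨hz, Eventually.of_forall hzΩ⟩
  have hmin : ∀ {f : En n → ℝ}, (∀ y ∈ Ω, |f y| ≤ M) →
      Tendsto (fun k => min (lEnv Ω f (z k)) (lEnv Ω f x)) atTop (𝓝 (lEnv Ω f x)) := by
    refine fun {f} hf => tendsto_order.2 ⟨fun a ha => ?_, fun a ha =>
      Eventually.of_forall fun k => (min_le_right _ _).trans_lt ha⟩
    exact (hzW.eventually (lowerSemicontinuousOn_lEnv hf x hx a ha)).mono fun k hk => lt_min hk ha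
  let r : ℕ → Fin m₁ → ℝ := fun k l => if l = j then lEnv Ω (fun y => v1 (i k) y j) (z k) else
    min (lEnv Ω (fun y => u1 y l) (z k)) (lEnv Ω (fun y => u1 y l) x)
  let s : ℕ → Fin m₂ → ℝ := fun k l =>
    max (uEnv Ω (fun y => u2 y l) (z k)) (uEnv Ω (fun y => u2 y l) x)
  have hr : Tendsto r atTop (𝓝 fun l => lEnv Ω (fun y => u1 y l) x) := by
    refine tendsto_pi_nhds.2 fun l => ?_
    by_cases hl : l = j
    · subst hl
      simpa [r] using hvlim
    · simpa [r, hl] using hmin (hu1 l)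
  have hs : Tendsto s atTop (𝓝 fun l => uEnv Ω (fun y => u2 y l) x) := by
    refine tendsto_pi_nhds.2 fun l => ?_
    have := (hmin (f := fun y => -u2 y l) (by simpa using hu2 l)).neg
    simpa only [s, uEnv_eq_neg_lEnv_neg, max_neg_neg] using this
  have hnonneg : ∀ k, 0 ≤ F (z k) (r k) (s k) (gradient φ (z k)) (hess φ (z k)) := by
    intro k
    have hsymm := hess_isSymm hφ (z k)
    have h := hsol (i k) (z k) (hzΩ k) (ψ k) (hψ k) (htψ k)
    rw [hgrad, hhess] at h
    refine (h.trans (hFs _ (hzΩ k) _ _ _ _ _ hsymm fun l => ?_)).trans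
      (hFr _ (hzΩ k) _ _ _ _ _ hsymm (fun l => ?_) (by simp [r]))
    · exact (uEnv_mono (hv2 _ l) (hu2 l) (fun y hy => (hlub l y hy).1 ⟨i k, rfl⟩)
        (hzΩ k)).trans (le_max_left _ _)
    · by_cases hl : l = j
      · subst hl
        simp [r]
      · simp only [r, if_neg hl]
        exact (min_le_left _ _).trans (lEnv_mono (hu1 l) (hv1 _ l)
          (fun y hy => (hglb l y hy).1 ⟨i k, rfl⟩) (hzΩ k))
  have hlim := (hFc (x, (fun l => lEnv Ω (fun y => u1 y l) x), (fun l => uEnv Ω (fun y => u2 y l) x),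
    gradient φ x, hess φ x) ⟨hx, trivial⟩).tendsto.comp
    (tendsto_nhdsWithin_iff.2 ⟨hz.prodMk_nhds (hr.prodMk_nhds (hs.prodMk_nhds
      ((((continuous_gradient hφ).tendsto x).comp hz).prodMk_nhds
        (((continuous_hess hφ).tendsto x).comp hz)))),
      Eventually.of_forall fun k => ⟨hzΩ k, trivial⟩⟩)
  exact ge_of_tendsto' hlim hnonneg

/-- The operator obtained by reflecting all variables of `F` and exchanging the two blocks. -/
def reflectOp {n m₁ m₂ : ℕ} (F : Op n m₁ m₂) : Op n m₂ m₁ :=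
  fun x r s p X => -F x (-s) (-r) (-p) (-X)

lemma OpContinuousOn.reflectOp {n m₁ m₂ : ℕ} {Ω : Set (En n)} {F : Op n m₁ m₂}
    (hF : OpContinuousOn Ω F) : OpContinuousOn Ω (reflectOp F) := by
  have hc : Continuous fun q : En n × (Fin m₂ → ℝ) × (Fin m₁ → ℝ) × En n × Symn n =>
      (q.1, -q.2.2.1, -q.2.1, -q.2.2.2.1, -q.2.2.2.2) := by fun_prop
  exact (ContinuousOn.comp hF hc.continuousOn fun q hq => ⟨hq.1, trivial⟩).neg

lemma isGLB_range_neg {ι : Type*} {f : ι → ℝ} {a : ℝ} (h : IsLUB (Set.range f) a) :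
    IsGLB (Set.range fun i => -f i) (-a) := by
  simpa [← Set.image_neg_eq_neg, ← Set.range_comp, Function.comp_def] using h.neg

lemma isLUB_range_neg {ι : Type*} {f : ι → ℝ} {a : ℝ} (h : IsGLB (Set.range f) a) :
    IsLUB (Set.range fun i => -f i) (-a) := by
  simpa [← Set.image_neg_eq_neg, ← Set.range_comp, Function.comp_def] using h.neg

lemma touchBelow_neg_iff {n : ℕ} {Ω : Set (En n)} {φ f : En n → ℝ} {x : En n} :
    TouchBelow Ω (fun y => -φ y) (fun y => -f y) x ↔ TouchAbove Ω φ f x := by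
  simp [TouchBelow, TouchAbove]

/-- Stability of the subsolution inequality for one operator under taking infima of the first
and suprema of the second components of a family. -/
lemma subsolution_sup {n m₁ m₂ : ℕ} {ι : Type*} {Ω : Set (En n)} (hΩ : IsOpen Ω)
    {F : Op n m₁ m₂} (j : Fin m₂) (hFc : OpContinuousOn Ω F)
    (hFr : ∀ x ∈ Ω, ∀ (r ρ : Fin m₁ → ℝ) (s : Fin m₂ → ℝ) (p : En n) (X : Symn n), X.IsSymm →
      (∀ i, r i ≤ ρ i) → F x r s p X ≤ F x ρ s p X)
    (hFs : ∀ x ∈ Ω, ∀ (r : Fin m₁ → ℝ) (s σ : Fin m₂ → ℝ) (p : En n) (X : Symn n), X.IsSymm →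
      (∀ i, s i ≤ σ i) → s j = σ j → F x r σ p X ≤ F x r s p X)
    {v1 : ι → En n → Fin m₁ → ℝ} {v2 : ι → En n → Fin m₂ → ℝ}
    {u1 : En n → Fin m₁ → ℝ} {u2 : En n → Fin m₂ → ℝ} {M : ℝ}
    (hv1 : ∀ i k, ∀ y ∈ Ω, |v1 i y k| ≤ M) (hv2 : ∀ i k, ∀ y ∈ Ω, |v2 i y k| ≤ M)
    (hu1 : ∀ k, ∀ y ∈ Ω, |u1 y k| ≤ M) (hu2 : ∀ k, ∀ y ∈ Ω, |u2 y k| ≤ M)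
    (hglb : ∀ k, ∀ y ∈ Ω, IsGLB (Set.range fun i => v1 i y k) (u1 y k))
    (hlub : ∀ k, ∀ y ∈ Ω, IsLUB (Set.range fun i => v2 i y k) (u2 y k))
    (hsol : ∀ i, ∀ x ∈ Ω, ∀ φ : En n → ℝ, ContDiff ℝ 2 φ →
      TouchAbove Ω φ (uEnv Ω fun y => v2 i y j) x →
      F x (fun k => lEnv Ω (fun y => v1 i y k) x) (fun k => uEnv Ω (fun y => v2 i y k) x)
        (gradient φ x) (hess φ x) ≤ 0)
    {x : En n} (hx : x ∈ Ω) {φ : En n → ℝ} (hφ : ContDiff ℝ 2 φ)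
    (ht : TouchAbove Ω φ (uEnv Ω fun y => u2 y j) x) :
    F x (fun k => lEnv Ω (fun y => u1 y k) x) (fun k => uEnv Ω (fun y => u2 y k) x)
      (gradient φ x) (hess φ x) ≤ 0 := by
  have hl : ∀ f : En n → ℝ, lEnv Ω (fun y => -f y) = fun y => -uEnv Ω f y := fun f =>
    funext fun y => by simp [uEnv_eq_neg_lEnv_neg]
  have hu : ∀ f : En n → ℝ, uEnv Ω (fun y => -f y) = fun y => -lEnv Ω f y := fun f =>
    funext fun y => by simp [uEnv_eq_neg_lEnv_neg]
  have hpi : ∀ {m : ℕ} (g : Fin m → ℝ), (-fun k => -g k) = g := fun g => by ext; simp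
  have key := supersolution_inf hΩ (F := reflectOp F) j hFc.reflectOp
    (v1 := fun i y k => -v2 i y k) (v2 := fun i y k => -v1 i y k)
    (u1 := fun y k => -u2 y k) (u2 := fun y k => -u1 y k) (M := M) (φ := fun y => -φ y)
    (fun x hx r s σ p X hX h => neg_le_neg
      (hFr x hx _ _ _ _ _ hX.neg fun i => neg_le_neg (h i)))
    (fun x hx r ρ s p X hX h hj => neg_le_neg
      (hFs x hx _ _ _ _ _ hX.neg (fun i => neg_le_neg (h i)) (by simp [hj])))
    (by simpa using hv2) (by simpa using hv1) (by simpa using hu2) (by simpa using hu1)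
    (fun k y hy => isGLB_range_neg (hlub k y hy)) (fun k y hy => isLUB_range_neg (hglb k y hy))
    (fun i x hx φ hφ ht => ?_) hx hφ.neg (by rw [hl]; exact touchBelow_neg_iff.2 ht)
  · simpa only [reflectOp, hl, hu, hpi, gradient_neg, hess_neg, neg_neg, Left.nonneg_neg_iff]
      using key
  · have := hsol i x hx (fun y => -φ y) hφ.neg
      (touchBelow_neg_iff.1 (by simpa only [hl, neg_neg] using ht))
    simpa only [reflectOp, hl, hu, hpi, gradient_neg, hess_neg, Left.nonneg_neg_iff] using this

lemma abs_le_of_isGLB_range {ι : Type*} [Nonempty ι] {f : ι → ℝ} {a M : ℝ} (hf : ∀ i, |f i| ≤ M)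
    (h : IsGLB (Set.range f) a) : |a| ≤ M := by
  obtain ⟨i⟩ := ‹Nonempty ι›
  refine abs_le.2 ⟨h.2 ?_, (h.1 ⟨i, rfl⟩).trans (abs_le.1 (hf i)).2⟩
  rintro _ ⟨k, rfl⟩
  exact (abs_le.1 (hf k)).1

lemma abs_le_of_isLUB_range {ι : Type*} [Nonempty ι] {f : ι → ℝ} {a M : ℝ} (hf : ∀ i, |f i| ≤ M)
    (h : IsLUB (Set.range f) a) : |a| ≤ M := by
  simpa using abs_le_of_isGLB_range (by simpa using hf) (isGLB_range_neg h)

/-- Lemma on infima/suprema of super-sub solutions: if S is a nonempty,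
uniformly bounded set of super-sub solutions, u1 is the pointwise infimum over S of the
first components, u2 the pointwise supremum of the second components, and the lower
envelopes of u1 (resp. upper envelopes of u2) are finite, then (u1, u2) is a super-sub
solution. -/
theorem inf_sup_superSub {n m₁ m₂ : ℕ} (hm₁ : 1 ≤ m₁)
    (Ω : Set (En n)) (hΩo : IsOpen Ω) (hΩb : IsBounded Ω)
    (F1 : Fin m₁ → Op n m₁ m₂) (F2 : Fin m₂ → Op n m₁ m₂)
    (hF1c : ∀ j, OpContinuousOn Ω (F1 j)) (hF2c : ∀ j, OpContinuousOn Ω (F2 j))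
    (hF1e : ∀ j, DegElliptic Ω (F1 j)) (hF2e : ∀ j, DegElliptic Ω (F2 j))
    (hQM : BalancedQM Ω F1 F2)
    (S : Set ((En n → Fin m₁ → ℝ) × (En n → Fin m₂ → ℝ)))
    (hS : S.Nonempty)
    (hSsol : ∀ v ∈ S, SuperSub Ω F1 F2 v.1 v.2)
    (M : ℝ) (hSbd : ∀ v ∈ S, ∀ x ∈ Ω, (∀ i, |v.1 x i| ≤ M) ∧ (∀ i, |v.2 x i| ≤ M))
    (u1 : En n → Fin m₁ → ℝ) (u2 : En n → Fin m₂ → ℝ)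
    (hu1 : ∀ x j, u1 x j = sInf ((fun v => v.1 x j) '' S))
    (hu2 : ∀ x j, u2 x j = sSup ((fun v => v.2 x j) '' S))
    (hfin1 : ∀ j, ∀ x ∈ Ω, ⊥ < liminf (fun y => (u1 y j : EReal)) (𝓝[Ω] x))
    (hfin2 : ∀ j, ∀ x ∈ Ω, limsup (fun y => (u2 y j : EReal)) (𝓝[Ω] x) < ⊤) :
    SuperSub Ω F1 F2 u1 u2 := by
  have : Nonempty S := hS.to_subtype
  have hv1 : ∀ (i : S) k, ∀ y ∈ Ω, |i.1.1 y k| ≤ M := fun i k y hy => (hSbd i i.2 y hy).1 k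
  have hv2 : ∀ (i : S) k, ∀ y ∈ Ω, |i.1.2 y k| ≤ M := fun i k y hy => (hSbd i i.2 y hy).2 k
  have hglb : ∀ k, ∀ y ∈ Ω, IsGLB (Set.range fun i : S => i.1.1 y k) (u1 y k) := by
    intro k y hy
    rw [hu1, Set.image_eq_range]
    refine isGLB_csInf (Set.range_nonempty _) ⟨-M, ?_⟩
    rintro _ ⟨i, rfl⟩
    exact (abs_le.1 (hv1 i k y hy)).1
  have hlub : ∀ k, ∀ y ∈ Ω, IsLUB (Set.range fun i : S => i.1.2 y k) (u2 y k) := by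
    intro k y hy
    rw [hu2, Set.image_eq_range]
    refine isLUB_csSup (Set.range_nonempty _) ⟨M, ?_⟩
    rintro _ ⟨i, rfl⟩
    exact (abs_le.1 (hv2 i k y hy)).2
  have hb1 : ∀ k, ∀ y ∈ Ω, |u1 y k| ≤ M := fun k y hy =>
    abs_le_of_isGLB_range (fun i => hv1 i k y hy) (hglb k y hy)
  have hb2 : ∀ k, ∀ y ∈ Ω, |u2 y k| ≤ M := fun k y hy =>
    abs_le_of_isLUB_range (fun i => hv2 i k y hy) (hlub k y hy)
  exact ⟨⟨M, fun y hy k => hb1 k y hy⟩, ⟨M, fun y hy k => hb2 k y hy⟩,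
    fun j x hx φ hφ ht => supersolution_inf hΩo j (hF1c j) (hQM.1 j) (hQM.2.1 j)
      hv1 hv2 hb1 hb2 hglb hlub (fun i => (hSsol i i.2).2.2.1 j) hx hφ ht,
    fun j x hx φ hφ ht => subsolution_sup hΩo j (hF2c j) (hQM.2.2.1 j) (hQM.2.2.2 j)
      hv1 hv2 hb1 hb2 hglb hlub (fun i => (hSsol i i.2).2.2.2 j) hx hφ ht⟩
end
end

section
/- (Uniqueness for the Dirichlet problem.) Let the system F_j(x,u(x),Du_j(x),D²u_j(x)) = 0, j = 1,…,m₁+m₂, be degenerate elliptic and balanced quasi-monotone, and assume conditions (i) and (ii). If u and v are continuous functions on the closure of Ω, both are solutions of the system in Ω, and u = v = 0 on ∂Ω, then u = v in Ω. -/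
open Filter Topology Matrix Bornology

noncomputable section

section Auxiliary

open scoped RealInnerProductSpace Pointwise

theorem abs_segment_increment_le {E : Type*} [NormedAddCommGroup E] [InnerProductSpace ℝ E]
    {W : E → ℝ} {T : E →L[ℝ] E} {C η M t : ℝ} {z₀ h k p g : E} (hM : 0 < M) (hη : 0 ≤ η)
    (ht : 0 ≤ t) (ht1 : t + 1 / M ≤ 1) (hC : 0 ≤ C)
    (hW : ∀ z, |W z - W k - ⟪g, z - k⟫| ≤ C * ‖z - k‖ ^ 2)
    (hk : ‖k - (z₀ + t • h)‖ ≤ 1 / M * ‖h‖)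
    (hg : ‖g - p - T (k - z₀)‖ ≤ η * ‖k - z₀‖) :
    |(W (z₀ + (t + 1 / M) • h) - (t + 1 / M) * ⟪p, h⟫ - (t + 1 / M) ^ 2 / 2 * ⟪T h, h⟫)
      - (W (z₀ + t • h) - t * ⟪p, h⟫ - t ^ 2 / 2 * ⟪T h, h⟫)|
      ≤ ((5 * C + 2 * ‖T‖) * (1 / M) ^ 2 + 2 * η * (1 / M)) * ‖h‖ ^ 2 := by
  set s : ℝ := 1 / M with hs
  have hs0 : 0 < s := by positivity
  have hs1 : s ≤ 1 := by linarith
  set r := ‖h‖ with hr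
  have hr0 : 0 ≤ r := norm_nonneg _
  set d := k - (z₀ + t • h) with hd
  have e1 := hW (z₀ + (t + s) • h)
  have e2 := hW (z₀ + t • h)
  have d2 : z₀ + t • h - k = -d := by rw [hd]; abel
  have d1 : z₀ + (t + s) • h - k = s • h - d := by rw [hd, add_smul]; abel
  have d3 : k - z₀ = t • h + d := by rw [hd]; abel
  rw [d1] at e1
  rw [d2] at e2
  rw [d3] at hg
  have n1 : ‖s • h - d‖ ≤ 2 * s * r := by
    calc ‖s • h - d‖ ≤ ‖s • h‖ + ‖d‖ := norm_sub_le _ _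
      _ ≤ s * r + s * r := by
          gcongr
          rw [norm_smul, Real.norm_of_nonneg hs0.le]
      _ = _ := by ring
  have n3 : ‖t • h + d‖ ≤ 2 * r := by
    calc ‖t • h + d‖ ≤ ‖t • h‖ + ‖d‖ := norm_add_le _ _
      _ ≤ t * r + s * r := by
          gcongr
          rw [norm_smul, Real.norm_of_nonneg ht]
      _ ≤ 2 * r := by nlinarith
  set e := g - p - T (t • h + d) with he
  have hge : g = p + t • T h + T d + e := by rw [he, map_add, map_smul]; abel
  have i1 : ⟪g, s • h - d⟫ - ⟪g, -d⟫
      = s * (⟪p, h⟫ + t * ⟪T h, h⟫ + ⟪T d, h⟫ + ⟪e, h⟫) := by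
    rw [← inner_sub_right, sub_neg_eq_add, sub_add_cancel, inner_smul_right, hge]
    simp only [inner_add_left, real_inner_smul_left]
  have b1 : |⟪T d, h⟫| ≤ ‖T‖ * s * r ^ 2 := by
    calc |⟪T d, h⟫| ≤ ‖T d‖ * ‖h‖ := abs_real_inner_le_norm _ _
      _ ≤ (‖T‖ * (s * r)) * r := by
        gcongr
        exact (T.le_opNorm d).trans (by gcongr)
      _ = _ := by ring
  have b2 : |⟪e, h⟫| ≤ 2 * η * r ^ 2 := by
    calc |⟪e, h⟫| ≤ ‖e‖ * ‖h‖ := abs_real_inner_le_norm _ _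
      _ ≤ (η * (2 * r)) * r := by
        gcongr
        exact hg.trans (by gcongr)
      _ = _ := by ring
  have b3 : |⟪T h, h⟫| ≤ ‖T‖ * r ^ 2 := by
    calc |⟪T h, h⟫| ≤ ‖T h‖ * ‖h‖ := abs_real_inner_le_norm _ _
      _ ≤ (‖T‖ * r) * r := by
        gcongr
        exact T.le_opNorm h
      _ = _ := by ring
  have c1 : C * ‖s • h - d‖ ^ 2 ≤ C * (2 * s * r) ^ 2 := by gcongr
  have c2 : C * ‖-d‖ ^ 2 ≤ C * (s * r) ^ 2 := by rw [norm_neg]; gcongr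
  rw [abs_le] at *
  have T0 : 0 ≤ ‖T‖ * s ^ 2 * r ^ 2 := by positivity
  have m1 := mul_le_mul_of_nonneg_left b1.1 hs0.le
  have m1' := mul_le_mul_of_nonneg_left b1.2 hs0.le
  have m2 := mul_le_mul_of_nonneg_left b2.1 hs0.le
  have m2' := mul_le_mul_of_nonneg_left b2.2 hs0.le
  have m3 := mul_le_mul_of_nonneg_left b3.1 (sq_nonneg s)
  have m3' := mul_le_mul_of_nonneg_left b3.2 (sq_nonneg s)
  constructor <;> linarith

theorem isLittleO_second_order_of_dense {E : Type*} [NormedAddCommGroup E]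
    [InnerProductSpace ℝ E] {W : E → ℝ} {G : E → E} {K : Set E} {C : ℝ} (hC : 0 ≤ C)
    (hW : ∀ k ∈ K, ∀ z, |W z - W k - ⟪G k, z - k⟫| ≤ C * ‖z - k‖ ^ 2)
    {z₀ : E} {T : E →L[ℝ] E} (hG : HasFDerivWithinAt G T K z₀)
    (hK : ∀ ε > 0, ∀ᶠ r in 𝓝[>] (0 : ℝ), ∀ y : E, ‖y‖ ≤ 1 →
      ∃ k ∈ K, ‖k - (z₀ + r • y)‖ ≤ ε * r) :
    (fun h => W (z₀ + h) - W z₀ - ⟪G z₀, h⟫ - 1 / 2 * ⟪T h, h⟫)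
      =o[𝓝 0] fun h => ‖h‖ ^ 2 := by
  rw [Asymptotics.isLittleO_iff]
  intro η hη
  obtain ⟨N, hN⟩ := exists_nat_gt (2 * (5 * C + 2 * ‖T‖) / η)
  have hM : (0 : ℝ) < N := lt_of_le_of_lt (by positivity) hN
  have hder := hG.isLittleO
  rw [Asymptotics.isLittleO_iff] at hder
  have hder := hder (show 0 < η / 4 by positivity)
  rw [eventually_nhdsWithin_iff, Metric.eventually_nhds_iff] at hder
  obtain ⟨ρ, hρ, hder⟩ := hder
  have hd := hK (1 / N) (by positivity)
  rw [eventually_nhdsWithin_iff, Metric.eventually_nhds_iff] at hd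
  obtain ⟨ρ', hρ', hd⟩ := hd
  rw [Metric.eventually_nhds_iff]
  refine ⟨min (ρ / 2) ρ', by positivity, fun h hh => ?_⟩
  rw [dist_zero_right, lt_min_iff] at hh
  rcases eq_or_ne h 0 with rfl | h0
  · simp
  have hr : 0 < ‖h‖ := norm_pos_iff.2 h0
  have step : ∀ i : ℕ, i ≤ N →
      |(W (z₀ + ((i : ℝ) / N) • h) - ((i : ℝ) / N) * ⟪G z₀, h⟫
          - ((i : ℝ) / N) ^ 2 / 2 * ⟪T h, h⟫) - W z₀|
        ≤ i * (((5 * C + 2 * ‖T‖) * (1 / N) ^ 2 + 2 * (η / 4) * (1 / N)) * ‖h‖ ^ 2) := by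
    intro i
    induction i with
    | zero => simp
    | succ i ih =>
      intro hi
      have ih := ih (by omega)
      have hi' : ((i : ℝ) + 1) ≤ N := by exact_mod_cast hi
      have ht1 : (i : ℝ) / N + 1 / N ≤ 1 := by
        rw [← add_div, div_le_one hM]; exact hi'
      have ht0 : (0 : ℝ) ≤ (i : ℝ) / N := by positivity
      have hty : ‖((i : ℝ) / N) • (‖h‖⁻¹ • h)‖ ≤ 1 := by
        rw [norm_smul, norm_smul, norm_inv, norm_norm, inv_mul_cancel₀ hr.ne',
          Real.norm_of_nonneg ht0, mul_one]
        have : (0 : ℝ) ≤ 1 / N := by positivity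
        linarith
      obtain ⟨k, hkK, hk⟩ := hd (y := ‖h‖) (by simpa using hh.2) hr _ hty
      have : ‖h‖ • ((i : ℝ) / N) • (‖h‖⁻¹ • h) = ((i : ℝ) / N) • h := by
        rw [smul_comm, smul_smul ‖h‖, mul_inv_cancel₀ hr.ne', one_smul]
      rw [this] at hk
      have hkz : ‖k - z₀‖ < ρ := by
        have e : k - z₀ = (k - (z₀ + ((i : ℝ) / N) • h)) + ((i : ℝ) / N) • h := by abel
        calc ‖k - z₀‖ ≤ 1 / N * ‖h‖ + (i : ℝ) / N * ‖h‖ := by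
              rw [e]
              refine (norm_add_le _ _).trans (add_le_add hk ?_)
              rw [norm_smul, Real.norm_of_nonneg ht0]
          _ ≤ ‖h‖ := by nlinarith
          _ < ρ := by linarith
      have := abs_segment_increment_le (T := T) (p := G z₀) hM (by positivity : 0 ≤ η / 4) ht0 ht1
        hC (hW k hkK) hk (hder (by rwa [dist_eq_norm]) hkK)
      push_cast
      rw [add_div]
      rw [abs_le] at *
      constructor <;> linarith
  have := step N le_rfl
  rw [div_self hM.ne', one_smul] at this
  have hN2 : (5 * C + 2 * ‖T‖) / N ≤ η / 2 := by
    rw [div_lt_iff₀ hη] at hN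
    rw [div_le_iff₀ hM]; linarith
  have e3 : (N : ℝ) * (((5 * C + 2 * ‖T‖) * (1 / N) ^ 2 + 2 * (η / 4) * (1 / N)) * ‖h‖ ^ 2)
      = ((5 * C + 2 * ‖T‖) / N + η / 2) * ‖h‖ ^ 2 := by field_simp; ring
  rw [e3] at this
  rw [Real.norm_eq_abs, Real.norm_of_nonneg (by positivity)]
  have e4 : W (z₀ + h) - W z₀ - ⟪G z₀, h⟫ - 1 / 2 * ⟪T h, h⟫
    = W (z₀ + h) - 1 * ⟪G z₀, h⟫ - 1 ^ 2 / 2 * ⟪T h, h⟫ - W z₀ := by ring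
  rw [e4]
  refine this.trans ?_
  gcongr
  linarith

theorem eventually_exists_near_of_density_one {E : Type*} [NormedAddCommGroup E]
    [NormedSpace ℝ E] [FiniteDimensional ℝ E] [MeasurableSpace E] [BorelSpace E]
    (μ : MeasureTheory.Measure E) [μ.IsAddHaarMeasure] {K : Set E} {z₀ : E}
    (h : Tendsto (fun r => μ (K ∩ Metric.closedBall z₀ r) / μ (Metric.closedBall z₀ r))
      (𝓝[>] 0) (𝓝 1)) {ε : ℝ} (hε : 0 < ε) :
    ∀ᶠ r in 𝓝[>] (0 : ℝ), ∀ y : E, ‖y‖ ≤ 1 → ∃ k ∈ K, ‖k - (z₀ + r • y)‖ ≤ ε * r := by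
  obtain ⟨t, -, htf, hcov⟩ := (isCompact_closedBall (0 : E) 1).finite_cover_balls (half_pos hε)
  have hev : ∀ᶠ r in 𝓝[>] (0 : ℝ), ∀ c ∈ t,
      (K ∩ ({z₀} + r • Metric.closedBall c (ε / 2))).Nonempty := by
    rw [htf.eventually_all]
    intro c _
    exact MeasureTheory.Measure.eventually_nonempty_inter_smul_of_density_one μ K z₀ h _
      measurableSet_closedBall (Metric.measure_closedBall_pos μ c (half_pos hε)).ne'
  filter_upwards [hev, self_mem_nhdsWithin] with r hr hr0 y hy
  have hr0 : 0 < r := hr0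
  obtain ⟨c, hc, hyc⟩ := Set.mem_iUnion₂.1 (hcov (mem_closedBall_zero_iff.2 hy))
  obtain ⟨k, hkK, hk⟩ := hr c hc
  refine ⟨k, hkK, ?_⟩
  obtain ⟨a, ha, b', hb', rfl⟩ := Set.mem_add.1 hk
  obtain ⟨b, hb, rfl⟩ := Set.mem_smul_set.1 hb'
  rw [Set.mem_singleton_iff] at ha
  subst ha
  have e : a + r • b - (a + r • y) = r • ((b - c) + (c - y)) := by
    rw [add_sub_add_left_eq_sub, ← smul_sub]; congr 1; abel
  rw [e, norm_smul, Real.norm_of_nonneg hr0.le, mul_comm]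
  gcongr
  refine (norm_add_le _ _).trans ?_
  rw [mem_closedBall_iff_norm] at hb
  rw [mem_ball_iff_norm'] at hyc
  linarith

theorem gradient_dist_le_of_contact {E : Type*} [NormedAddCommGroup E] [InnerProductSpace ℝ E]
    {W : E → ℝ} {c : ℝ} (hc : 0 ≤ c) {z₁ z₂ p₁ p₂ : E}
    (hl₁ : ∀ z, W z₁ + ⟪p₁, z - z₁⟫ - c / 2 * ‖z - z₁‖ ^ 2 ≤ W z)
    (hl₂ : W z₂ + ⟪p₂, z₁ - z₂⟫ - c / 2 * ‖z₁ - z₂‖ ^ 2 ≤ W z₁)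
    (hu₂ : ∀ z, W z ≤ W z₂ + ⟪p₂, z - z₂⟫) :
    ‖p₁ - p₂‖ ≤ c * ‖z₁ - z₂‖ := by
  have key : ∀ h : E, ⟪p₁ - p₂, h⟫ ≤ c / 2 * ‖h‖ ^ 2 + c / 2 * ‖z₁ - z₂‖ ^ 2 := by
    intro h
    have a := hl₁ (z₁ + h)
    have b := hu₂ (z₁ + h)
    rw [add_sub_cancel_left] at a
    rw [add_sub_right_comm, inner_add_right] at b
    rw [inner_sub_left]
    linarith
  rcases eq_or_ne p₁ p₂ with rfl | hp
  · rw [sub_self, norm_zero]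
    positivity
  · have hq : 0 < ‖p₁ - p₂‖ := norm_pos_iff.2 (sub_ne_zero.2 hp)
    rcases eq_or_ne z₁ z₂ with rfl | hz
    · exfalso
      have kk : ∀ s : ℝ, 0 < s → s * ‖p₁ - p₂‖ ^ 2 ≤ c / 2 * (s ^ 2 * ‖p₁ - p₂‖ ^ 2) := by
        intro s hs
        have := key (s • (p₁ - p₂))
        rw [inner_smul_right, real_inner_self_eq_norm_sq, norm_smul,
          Real.norm_of_nonneg hs.le] at this
        simp only [sub_self, norm_zero] at this
        nlinarith
      have kk' : ∀ s : ℝ, 0 < s → 1 ≤ c / 2 * s := by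
        intro s hs
        have := kk s hs
        have h2 : 0 < s * ‖p₁ - p₂‖ ^ 2 := by positivity
        by_contra! hc
        nlinarith
      have h1 := kk' 1 one_pos
      have h2 := kk' (1 / (2 * c)) (by have : 0 < c := by linarith
                                       positivity)
      have : 0 < c := by linarith
      have e : c / 2 * (1 / (2 * c)) = 1 / 4 := by field_simp; norm_num
      linarith
    · have hr : 0 < ‖z₁ - z₂‖ := norm_pos_iff.2 (sub_ne_zero.2 hz)
      have := key ((‖z₁ - z₂‖ / ‖p₁ - p₂‖) • (p₁ - p₂))
      rw [inner_smul_right, real_inner_self_eq_norm_sq, norm_smul,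
        Real.norm_of_nonneg (by positivity), div_mul_cancel₀ _ hq.ne'] at this
      have e : ‖z₁ - z₂‖ / ‖p₁ - p₂‖ * ‖p₁ - p₂‖ ^ 2 = ‖z₁ - z₂‖ * ‖p₁ - p₂‖ := by
        field_simp
      rw [e] at this
      have : ‖z₁ - z₂‖ * ‖p₁ - p₂‖ ≤ ‖z₁ - z₂‖ * (c * ‖z₁ - z₂‖) := by linarith
      exact le_of_mul_le_mul_left this hr

theorem gradient_eq_of_contact {E : Type*} [NormedAddCommGroup E] [InnerProductSpace ℝ E]
    {W : E → ℝ} {c : ℝ} (hc : 0 ≤ c) {z₀ p q : E}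
    (hl : ∀ z, W z₀ + ⟪q, z - z₀⟫ - c / 2 * ‖z - z₀‖ ^ 2 ≤ W z)
    (hu : ∀ z, W z ≤ W z₀ + ⟪p, z - z₀⟫) : q = p := by
  have := gradient_dist_le_of_contact hc hl (p₂ := p) (z₂ := z₀) (by simp) hu
  rw [sub_self, norm_zero, mul_zero, norm_le_zero_iff, sub_eq_zero] at this
  exact this

theorem exists_contact_point {E : Type*} [NormedAddCommGroup E] [InnerProductSpace ℝ E]
    [FiniteDimensional ℝ E] {W : E → ℝ} (hWc : Continuous W) {δ : ℝ} (hδ : 0 < δ)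
    (hmax : ∀ z, W z ≤ W 0 - δ * ‖z‖ ^ 2) (p : E) :
    ∃ z, ‖z‖ ≤ ‖p‖ / δ ∧ ∀ z', W z' ≤ W z + ⟪p, z' - z⟫ := by
  have hpos : 0 ≤ ‖p‖ / δ := by positivity
  obtain ⟨z, hz, hzm⟩ := (isCompact_closedBall (0 : E) (‖p‖ / δ)).exists_isMaxOn
    ⟨0, by simpa using hpos⟩ (f := fun z => W z - ⟪p, z⟫) (by fun_prop)
  refine ⟨z, by simpa using hz, fun z' => ?_⟩
  rw [inner_sub_right]
  by_cases h : ‖z'‖ ≤ ‖p‖ / δ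
  · have : W z' - ⟪p, z'⟫ ≤ W z - ⟪p, z⟫ := hzm (by simpa using h)
    linarith
  · have h0 : W 0 - ⟪p, 0⟫ ≤ W z - ⟪p, z⟫ := hzm (by simpa using hpos)
    rw [inner_zero_right] at h0
    push Not at h
    have h1 := hmax z'
    have h2 := (abs_le.1 (abs_real_inner_le_norm p z')).1
    rw [div_lt_iff₀ hδ] at h
    nlinarith [norm_nonneg z']

theorem exists_contact_second_order {E : Type*} [NormedAddCommGroup E] [InnerProductSpace ℝ E]
    [FiniteDimensional ℝ E] {W : E → ℝ} (hWc : Continuous W) {c : ℝ} (hc : 0 ≤ c)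
    (hsemi : ∀ z, ∃ q, ∀ z', W z + ⟪q, z' - z⟫ - c / 2 * ‖z' - z‖ ^ 2 ≤ W z')
    {δ : ℝ} (hδ : 0 < δ) (hmax : ∀ z, W z ≤ W 0 - δ * ‖z‖ ^ 2) {ε : ℝ} (hε : 0 < ε) :
    ∃ (z₀ p : E) (T : E →L[ℝ] E), ‖z₀‖ ≤ ε ∧ ‖p‖ ≤ ε ∧
      (∀ z, W z ≤ W z₀ + ⟪p, z - z₀⟫) ∧
      (fun h => W (z₀ + h) - W z₀ - ⟪p, h⟫ - 1 / 2 * ⟪T h, h⟫) =o[𝓝 0] fun h => ‖h‖ ^ 2 := by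
  set r := min ε (ε * δ) with hr
  have hr0 : 0 < r := by positivity
  let K : Set E := {z | ‖z‖ ≤ ε ∧ ∃ p, ‖p‖ ≤ r ∧ ∀ z', W z' ≤ W z + ⟪p, z' - z⟫}
  have hex : ∀ z, ∃ g, z ∈ K → ‖g‖ ≤ r ∧ ∀ z', W z' ≤ W z + ⟪g, z' - z⟫ := by
    intro z
    by_cases hz : z ∈ K
    · obtain ⟨g, hg⟩ := hz.2
      exact ⟨g, fun _ => hg⟩
    · exact ⟨0, fun h => absurd h hz⟩
  choose G hG using hex
  have hlow : ∀ z ∈ K, ∀ z', W z + ⟪G z, z' - z⟫ - c / 2 * ‖z' - z‖ ^ 2 ≤ W z' := by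
    intro z hz
    obtain ⟨q, hq⟩ := hsemi z
    rw [← gradient_eq_of_contact hc hq (hG z hz).2]
    exact hq
  have hLip : LipschitzOnWith c.toNNReal G K := by
    refine LipschitzOnWith.of_dist_le_mul fun x hx y hy => ?_
    rw [dist_eq_norm, dist_eq_norm, Real.coe_toNNReal c hc]
    exact gradient_dist_le_of_contact hc (hlow x hx) (hlow y hy x) (hG y hy).2
  have himg : Metric.closedBall (0 : E) r ⊆ G '' K := by
    intro p hp
    rw [mem_closedBall_zero_iff] at hp
    obtain ⟨z, hz, hzp⟩ := exists_contact_point hWc hδ hmax p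
    have hzK : z ∈ K := by
      refine ⟨hz.trans ?_, p, hp, hzp⟩
      rw [div_le_iff₀ hδ]
      exact hp.trans (min_le_right _ _)
    exact ⟨z, hzK, gradient_eq_of_contact hc (hlow z hzK) hzp⟩
  let _ : MeasurableSpace E := borel E
  have _ : BorelSpace E := ⟨rfl⟩
  let μ : MeasureTheory.Measure E := MeasureTheory.Measure.hausdorffMeasure (Module.finrank ℝ E)
  have _ : μ.IsAddHaarMeasure := MeasureTheory.isAddHaarMeasure_hausdorffMeasure
  have hK0 : μ K ≠ 0 := by
    intro h0
    have h1 := hLip.hausdorffMeasure_image_le (d := Module.finrank ℝ E) (Nat.cast_nonneg _)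
    have h2 : μ (G '' K) = 0 := by
      refine le_antisymm (h1.trans ?_) zero_le
      rw [show MeasureTheory.Measure.hausdorffMeasure (Module.finrank ℝ E : ℝ) K = 0 from h0,
        mul_zero]
    exact (Metric.measure_closedBall_pos μ (0 : E) hr0).ne' (MeasureTheory.measure_mono_null himg h2)
  obtain ⟨z₀, hz₀K, hdiff, hdens⟩ : ∃ z ∈ K, DifferentiableWithinAt ℝ G K z ∧
      Tendsto (fun r => μ (K ∩ Metric.closedBall z r) / μ (Metric.closedBall z r))
        (𝓝[>] 0) (𝓝 1) := by
    have h1 := hLip.ae_differentiableWithinAt_of_mem (μ := μ)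
    have h2 := MeasureTheory.ae_imp_of_ae_restrict (Besicovitch.ae_tendsto_measure_inter_div μ K)
    by_contra! hcon
    refine hK0 (MeasureTheory.measure_mono_null ?_ (MeasureTheory.ae_iff.1 (h1.and h2)))
    intro z hz hz'
    exact hcon z hz (hz'.1 hz) (hz'.2 hz)
  refine ⟨z₀, G z₀, fderivWithin ℝ G K z₀, hz₀K.1, (hG z₀ hz₀K).1.trans (min_le_left _ _),
    (hG z₀ hz₀K).2, ?_⟩
  refine isLittleO_second_order_of_dense (C := c / 2) (by positivity) (fun k hk z => ?_)
    hdiff.hasFDerivWithinAt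
    (fun ε hε => eventually_exists_near_of_density_one μ hdens hε)
  have h1 := hlow k hk z
  have h2 := (hG k hk).2 z
  have h3 : 0 ≤ c / 2 * ‖z - k‖ ^ 2 := by positivity
  rw [abs_le]
  constructor <;> linarith

/-- `V` is the sup-convolution of `U` over the set `K` with parameter `l`. -/
structure IsSupConv {E : Type*} [NormedAddCommGroup E] (K : Set E) (U : E → ℝ) (l : ℝ)
    (V : E → ℝ) : Prop where
  continuous : Continuous V
  le : ∀ z, ∀ h ∈ K, U h - l / 2 * ‖h - z‖ ^ 2 ≤ V z
  exists_eq : ∀ z, ∃ h ∈ K, V z = U h - l / 2 * ‖h - z‖ ^ 2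

theorem exists_isSupConv {E : Type*} [NormedAddCommGroup E] {K : Set E} (hK : IsCompact K)
    (hne : K.Nonempty) {U : E → ℝ} (hU : ContinuousOn U K) (l : ℝ) :
    ∃ V, IsSupConv K U l V := by
  have : CompactSpace K := isCompact_iff_compactSpace.1 hK
  have : Nonempty K := hne.to_subtype
  have hU' : Continuous (K.domRestrict U) := hU.domRestrict
  let f : E → K → ℝ := fun z h => K.domRestrict U h - l / 2 * ‖(h : E) - z‖ ^ 2
  have hf : Continuous ↿f := by
    change Continuous fun q : E × K => K.domRestrict U q.2 - l / 2 * ‖(q.2 : E) - q.1‖ ^ 2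
    fun_prop
  have hfz : ∀ z, Continuous (f z) := fun z => hf.comp (by fun_prop : Continuous fun h => (z, h))
  refine ⟨fun z => sSup (f z '' Set.univ), isCompact_univ.continuous_sSup hf, fun z h hh => ?_,
    fun z => ?_⟩
  · exact le_csSup (isCompact_univ.image (hfz z)).bddAbove ⟨⟨h, hh⟩, trivial, rfl⟩
  · obtain ⟨h, -, hh⟩ := isCompact_univ.exists_sSup_image_eq Set.univ_nonempty (hfz z).continuousOn
    exact ⟨h, h.2, hh⟩

theorem IsSupConv.lower_bound {E : Type*} [NormedAddCommGroup E] [InnerProductSpace ℝ E]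
    {K : Set E} {U V : E → ℝ} {l : ℝ} (hV : IsSupConv K U l V) {z h : E} (hh : h ∈ K)
    (hz : V z = U h - l / 2 * ‖h - z‖ ^ 2) (a : E) :
    V z + ⟪l • (h - z), a⟫ - l / 2 * ‖a‖ ^ 2 ≤ V (z + a) := by
  have h1 := hV.le (z + a) h hh
  rw [← sub_sub, norm_sub_sq_real] at h1
  rw [real_inner_smul_left]
  linarith

theorem IsSupConv.upper_bound {E : Type*} [NormedAddCommGroup E] {K : Set E} {U V : E → ℝ}
    {l : ℝ} (hV : IsSupConv K U l V) {z h : E}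
    (hz : V z = U h - l / 2 * ‖h - z‖ ^ 2) {a : E} (ha : h + a ∈ K) :
    U (h + a) ≤ U h + (V (z + a) - V z) := by
  have h1 := hV.le (z + a) (h + a) ha
  rw [add_sub_add_right_eq_sub] at h1
  linarith

theorem sq_norm_sub_le_of_split {F : Type*} [NormedAddCommGroup F] [InnerProductSpace ℝ F]
    (x y z w : F) :
    ‖x - y‖ ^ 2 ≤ 3 * ‖z - w‖ ^ 2 + 3 * ‖x - z‖ ^ 2 + 3 * ‖y - w‖ ^ 2 := by
  have e : x - y = (z - w) + (x - z) - (y - w) := by abel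
  have h : ‖x - y‖ ≤ ‖z - w‖ + ‖x - z‖ + ‖y - w‖ := by
    rw [e]
    exact (norm_sub_le _ _).trans (by gcongr; exact norm_add_le _ _)
  calc ‖x - y‖ ^ 2 ≤ (‖z - w‖ + ‖x - z‖ + ‖y - w‖) ^ 2 := by gcongr
    _ ≤ _ := by
      nlinarith [sq_nonneg (‖z - w‖ - ‖x - z‖), sq_nonneg (‖z - w‖ - ‖y - w‖),
        sq_nonneg (‖x - z‖ - ‖y - w‖)]

theorem nonneg_of_quadratic_nonneg {A B : ℝ} {R : ℝ → ℝ}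
    (hR : R =o[𝓝[>] 0] fun t => t ^ 2) (h : ∀ t > 0, 0 ≤ t * A + t ^ 2 * B + R t) :
    0 ≤ A ∧ (A = 0 → 0 ≤ B) := by
  have hB : ∀ η > 0, ∀ᶠ t in 𝓝[>] (0 : ℝ), 0 < t ∧ 0 ≤ A + t * (B + η) := by
    intro η hη
    filter_upwards [hR.def hη, self_mem_nhdsWithin] with t ht ht0
    have ht0 : 0 < t := ht0
    refine ⟨ht0, ?_⟩
    rw [Real.norm_eq_abs, Real.norm_of_nonneg (by positivity)] at ht
    have h1 := h t ht0
    have h2 := (abs_le.1 ht).2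
    have h3 : 0 ≤ t * (A + t * (B + η)) := by nlinarith
    exact nonneg_of_mul_nonneg_right h3 ht0
  constructor
  · have hlim : Tendsto (fun t : ℝ => A + t * (B + 1)) (𝓝[>] 0) (𝓝 (A + 0 * (B + 1))) :=
      ((continuous_const.add (continuous_id.mul continuous_const)).tendsto 0).mono_left
        nhdsWithin_le_nhds
    rw [zero_mul, add_zero] at hlim
    exact ge_of_tendsto hlim ((hB 1 one_pos).mono fun t ht => ht.2)
  · rintro rfl
    refine le_of_forall_pos_le_add fun η hη => ?_
    obtain ⟨t, ht0, ht⟩ := (hB η hη).exists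
    rw [zero_add] at ht
    exact nonneg_of_mul_nonneg_right ht ht0

theorem isLittleO_along_ray {F : Type*} [NormedAddCommGroup F] [NormedSpace ℝ F] {R : F → ℝ}
    (hR : R =o[𝓝 0] fun a => ‖a‖ ^ 2) (a : F) :
    (fun t : ℝ => R (t • a)) =o[𝓝[>] 0] fun t => t ^ 2 := by
  have h0 : Tendsto (fun t : ℝ => t • a) (𝓝[>] 0) (𝓝 0) := by
    have : Continuous fun t : ℝ => t • a := by fun_prop
    simpa using (this.tendsto 0).mono_left nhdsWithin_le_nhds
  refine (hR.comp_tendsto h0).trans_isBigO ?_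
  refine Asymptotics.IsBigO.of_bound (‖a‖ ^ 2) (Eventually.of_forall fun t => ?_)
  simp [norm_smul, mul_pow, mul_comm]

theorem gradient_hessian_of_quadratic_lower {F : Type*} [NormedAddCommGroup F]
    [InnerProductSpace ℝ F] {f : F → ℝ} {l : ℝ} {q p x : F} {S : F →L[ℝ] F}
    (hl : ∀ a, f x + ⟪q, a⟫ - l / 2 * ‖a‖ ^ 2 ≤ f (x + a))
    (hf : (fun a => f (x + a) - f x - ⟪p, a⟫ - 1 / 2 * ⟪S a, a⟫) =o[𝓝 0] fun a => ‖a‖ ^ 2) :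
    q = p ∧ ∀ a, -l * ‖a‖ ^ 2 ≤ ⟪S a, a⟫ := by
  have key : ∀ a, 0 ≤ ⟪p - q, a⟫ ∧ (⟪p - q, a⟫ = 0 → 0 ≤ 1 / 2 * ⟪S a, a⟫ + l / 2 * ‖a‖ ^ 2) := by
    intro a
    refine nonneg_of_quadratic_nonneg (isLittleO_along_ray hf a) fun t ht => ?_
    have := hl (t • a)
    simp only [map_smul, inner_smul_right, real_inner_smul_left, norm_smul, inner_sub_left,
      mul_pow, Real.norm_eq_abs, sq_abs] at this ⊢
    linarith
  have hpq : p - q = 0 := by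
    have := (key (-(p - q))).1
    rw [inner_neg_right, real_inner_self_eq_norm_sq] at this
    exact norm_eq_zero.1 (pow_eq_zero_iff two_ne_zero |>.1 (by nlinarith [sq_nonneg ‖p - q‖]))
  refine ⟨(sub_eq_zero.1 hpq).symm, fun a => ?_⟩
  have := (key a).2 (by rw [hpq, inner_zero_left])
  linarith

/-- Approximate form of the theorem on sums for the quadratic penalization. -/
theorem exists_approx_jets {F : Type*} [NormedAddCommGroup F] [InnerProductSpace ℝ F]
    [FiniteDimensional ℝ F] {K₁ K₂ : Set F} (hK₁ : IsCompact K₁) (hK₂ : IsCompact K₂)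
    (h0₁ : 0 ∈ K₁) (h0₂ : 0 ∈ K₂) {U V : F → ℝ} (hU : ContinuousOn U K₁) (hV : ContinuousOn V K₂)
    (hU0 : U 0 = 0) (hV0 : V 0 = 0) {α : ℝ} (hα : 0 < α)
    (hmax : ∀ x ∈ K₁, ∀ y ∈ K₂, U x + V y ≤ α / 2 * ‖x - y‖ ^ 2) {ε : ℝ} (hε : 0 < ε) :
    ∃ x ∈ K₁, ∃ y ∈ K₂, ∃ (p q : F) (S T : F →L[ℝ] F),
      ‖x‖ ≤ ε ∧ ‖y‖ ≤ ε ∧ ‖p‖ ≤ ε ∧ ‖q‖ ≤ ε ∧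
      (∀ γ > 0, ∀ᶠ a in 𝓝 0, x + a ∈ K₁ →
        U (x + a) ≤ U x + ⟪p, a⟫ + 1 / 2 * ⟪S a, a⟫ + γ * ‖a‖ ^ 2) ∧
      (∀ γ > 0, ∀ᶠ a in 𝓝 0, y + a ∈ K₂ →
        V (y + a) ≤ V y + ⟪q, a⟫ + 1 / 2 * ⟪T a, a⟫ + γ * ‖a‖ ^ 2) ∧
      (∀ a, -(3 * α) * ‖a‖ ^ 2 ≤ ⟪S a, a⟫) ∧ (∀ a, -(3 * α) * ‖a‖ ^ 2 ≤ ⟪T a, a⟫) ∧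
      ∀ a b, ⟪S a, a⟫ + ⟪T b, b⟫ ≤ 3 * α * ‖a - b‖ ^ 2 + ε * (‖a‖ ^ 2 + ‖b‖ ^ 2) := by
  obtain ⟨U', hU'⟩ := exists_isSupConv hK₁ ⟨0, h0₁⟩ hU (3 * α)
  obtain ⟨V', hV'⟩ := exists_isSupConv hK₂ ⟨0, h0₂⟩ hV (3 * α)
  set l := 3 * α with hl
  have hl0 : 0 < l := by positivity
  set δ := ε / 2 with hδ
  have hδ0 : 0 < δ := by positivity
  let W : WithLp 2 (F × F) → ℝ := fun z =>
    U' z.fst + V' z.snd - l / 2 * ‖z.fst - z.snd‖ ^ 2 - δ * (‖z.fst‖ ^ 2 + ‖z.snd‖ ^ 2)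
  have ip : ∀ z w : WithLp 2 (F × F), ⟪z, w⟫ = ⟪z.fst, w.fst⟫ + ⟪z.snd, w.snd⟫ :=
    WithLp.prod_inner_apply
  have hWc : Continuous W := by
    have := hU'.continuous
    have := hV'.continuous
    fun_prop
  have hsemi : ∀ z, ∃ q, ∀ z', W z + ⟪q, z' - z⟫ - (3 * l + 2 * δ) / 2 * ‖z' - z‖ ^ 2 ≤ W z' := by
    intro z
    obtain ⟨h, hh, hz⟩ := hU'.exists_eq z.fst
    obtain ⟨k, hk, hkz⟩ := hV'.exists_eq z.snd
    refine ⟨WithLp.toLp 2 (l • (h - z.fst) - l • (z.fst - z.snd) - (2 * δ) • z.fst,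
      l • (k - z.snd) + l • (z.fst - z.snd) - (2 * δ) • z.snd), fun z' => ?_⟩
    obtain ⟨a, rfl⟩ : ∃ a, z' = z + a := ⟨z' - z, by abel⟩
    rw [add_sub_cancel_left]
    have h1 := hU'.lower_bound hh hz a.fst
    have h2 := hV'.lower_bound hk hkz a.snd
    simp only [W, WithLp.prod_norm_sq_eq_of_L2, ip, WithLp.add_fst, WithLp.add_snd,
      WithLp.toLp_fst, WithLp.toLp_snd]
    have e : z.fst + a.fst - (z.snd + a.snd) = (z.fst - z.snd) + (a.fst - a.snd) := by abel
    have h3 : ‖a.fst - a.snd‖ ^ 2 ≤ 2 * (‖a.fst‖ ^ 2 + ‖a.snd‖ ^ 2) := by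
      nlinarith [parallelogram_law_with_norm ℝ a.fst a.snd, norm_nonneg (a.fst + a.snd)]
    have h4 := mul_le_mul_of_nonneg_left h3 hl0.le
    rw [e, norm_add_sq_real, norm_add_sq_real z.fst, norm_add_sq_real z.snd]
    simp only [inner_sub_left, inner_add_left, inner_sub_right, real_inner_smul_left] at h1 h2 ⊢
    linarith
  have hWmax : ∀ z, W z ≤ W 0 - δ * ‖z‖ ^ 2 := by
    intro z
    obtain ⟨h, hh, hz⟩ := hU'.exists_eq z.fst
    obtain ⟨k, hk, hkz⟩ := hV'.exists_eq z.snd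
    have h1 := hU'.le 0 0 h0₁
    have h2 := hV'.le 0 0 h0₂
    have h3 := hmax h hh k hk
    have h4 := mul_le_mul_of_nonneg_left (sq_norm_sub_le_of_split h k z.fst z.snd) hα.le
    simp only [W, WithLp.prod_norm_sq_eq_of_L2, WithLp.zero_fst, WithLp.zero_snd]
    simp only [sub_zero, norm_zero, hU0, hV0] at h1 h2 ⊢
    rw [hz, hkz]
    linarith
  set M := 1 + 2 * l + 2 * δ with hM
  have hM0 : 0 < M := by positivity
  set ρ := ε / (M + 1 + M / l) with hρ
  have hρ0 : 0 < ρ := by positivity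
  have hρε : ρ * (M + 1 + M / l) = ε := div_mul_cancel₀ _ (by positivity)
  have hρM : 0 < ρ * M := by positivity
  have hρMl : 0 < ρ * (M / l) := by positivity
  obtain ⟨z, p, T, hz, hp, hcon, hexp⟩ :=
    exists_contact_second_order hWc (by positivity) hsemi hδ0 hWmax hρ0
  have fst_le : ∀ w : WithLp 2 (F × F), ‖w.fst‖ ≤ ‖w‖ := fun w => by
    refine le_of_sq_le_sq ?_ (norm_nonneg _)
    rw [WithLp.prod_norm_sq_eq_of_L2]
    nlinarith [sq_nonneg ‖w.snd‖]
  have snd_le : ∀ w : WithLp 2 (F × F), ‖w.snd‖ ≤ ‖w‖ := fun w => by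
    refine le_of_sq_le_sq ?_ (norm_nonneg _)
    rw [WithLp.prod_norm_sq_eq_of_L2]
    nlinarith [sq_nonneg ‖w.fst‖]
  obtain ⟨h, hh, hzh⟩ := hU'.exists_eq z.fst
  obtain ⟨k, hk, hzk⟩ := hV'.exists_eq z.snd
  let e : WithLp 2 (F × F) ≃L[ℝ] F × F := WithLp.prodContinuousLinearEquiv 2 ℝ F F
  let i₁ : F →L[ℝ] WithLp 2 (F × F) := (e.symm : _ →L[ℝ] _).comp (.inl ℝ F F)
  let i₂ : F →L[ℝ] WithLp 2 (F × F) := (e.symm : _ →L[ℝ] _).comp (.inr ℝ F F)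
  let π₁ : WithLp 2 (F × F) →L[ℝ] F := (ContinuousLinearMap.fst ℝ F F).comp (e : _ →L[ℝ] _)
  let π₂ : WithLp 2 (F × F) →L[ℝ] F := (ContinuousLinearMap.snd ℝ F F).comp (e : _ →L[ℝ] _)
  have i11 : ∀ a, (i₁ a).fst = a := fun a => rfl
  have i12 : ∀ a, (i₁ a).snd = 0 := fun a => rfl
  have i21 : ∀ a, (i₂ a).fst = 0 := fun a => rfl
  have i22 : ∀ a, (i₂ a).snd = a := fun a => rfl
  have p1 : ∀ w, π₁ w = w.fst := fun a => rfl
  have p2 : ∀ w, π₂ w = w.snd := fun a => rfl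
  have hP : ∀ x y w : F, ‖x‖ ≤ ρ → ‖y‖ ≤ ρ → ‖w‖ ≤ ρ →
      ‖w + l • (x - y) + (2 * δ) • x‖ ≤ ρ * M := by
    intro x y w hx hy hw
    calc ‖w + l • (x - y) + (2 * δ) • x‖ ≤ ‖w‖ + ‖l • (x - y)‖ + ‖(2 * δ) • x‖ := norm_add₃_le
      _ = ‖w‖ + l * ‖x - y‖ + 2 * δ * ‖x‖ := by
        rw [norm_smul, norm_smul, Real.norm_of_nonneg hl0.le, Real.norm_of_nonneg (by positivity)]
      _ ≤ ρ + l * (ρ + ρ) + 2 * δ * ρ := by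
        gcongr
        exact (norm_sub_le _ _).trans (add_le_add hx hy)
      _ = ρ * M := by rw [hM]; ring
  have hz1 := (fst_le z).trans hz
  have hz2 := (snd_le z).trans hz
  have hP1 := hP z.fst z.snd p.fst hz1 hz2 ((fst_le p).trans hp)
  have hP2 := hP z.snd z.fst p.snd hz2 hz1 ((snd_le p).trans hp)
  set P := p.fst + l • (z.fst - z.snd) + (2 * δ) • z.fst with hPdef
  set Q := p.snd + l • (z.snd - z.fst) + (2 * δ) • z.snd with hQdef
  let S₁ : F →L[ℝ] F := π₁.comp (T.comp i₁) + (l + 2 * δ) • .id ℝ F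
  let S₂ : F →L[ℝ] F := π₂.comp (T.comp i₂) + (l + 2 * δ) • .id ℝ F
  have norm_i₁ : ∀ a, ‖i₁ a‖ ^ 2 = ‖a‖ ^ 2 := fun a => by
    rw [WithLp.prod_norm_sq_eq_of_L2, i11, i12]; simp
  have norm_i₂ : ∀ a, ‖i₂ a‖ ^ 2 = ‖a‖ ^ 2 := fun a => by
    rw [WithLp.prod_norm_sq_eq_of_L2, i21, i22]; simp
  have e1 : (fun a => U' (z.fst + a) - U' z.fst - ⟪P, a⟫ - 1 / 2 * ⟪S₁ a, a⟫)
      =o[𝓝 0] fun a => ‖a‖ ^ 2 := by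
    have := hexp.comp_tendsto (i₁.continuous.tendsto' 0 0 (map_zero _))
    refine this.congr (fun a => ?_) norm_i₁
    simp only [Function.comp_apply, W, ip, WithLp.add_fst, WithLp.add_snd, i11, i12, S₁, P,
      _root_.add_apply, ContinuousLinearMap.comp_apply, _root_.smul_apply,
      ContinuousLinearMap.id_apply, inner_add_left, real_inner_smul_left, p1, inner_zero_right,
      add_zero, add_sub_right_comm z.fst a z.snd, norm_add_sq_real, inner_sub_left,
      real_inner_self_eq_norm_sq, norm_zero]
    ring
  have e2 : (fun a => V' (z.snd + a) - V' z.snd - ⟪Q, a⟫ - 1 / 2 * ⟪S₂ a, a⟫)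
      =o[𝓝 0] fun a => ‖a‖ ^ 2 := by
    have := hexp.comp_tendsto (i₂.continuous.tendsto' 0 0 (map_zero _))
    refine this.congr (fun a => ?_) norm_i₂
    simp only [Function.comp_apply, W, ip, WithLp.add_fst, WithLp.add_snd, i21, i22, S₂, Q,
      _root_.add_apply, ContinuousLinearMap.comp_apply, _root_.smul_apply,
      ContinuousLinearMap.id_apply, inner_add_left, real_inner_smul_left, p2, inner_zero_right,
      add_zero, ← sub_sub, norm_sub_sq_real _ a, norm_add_sq_real, inner_sub_left,
      real_inner_self_eq_norm_sq, norm_zero]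
    ring
  obtain ⟨g1, s1⟩ := gradient_hessian_of_quadratic_lower (hU'.lower_bound hh hzh) e1
  obtain ⟨g2, s2⟩ := gradient_hessian_of_quadratic_lower (hV'.lower_bound hk hzk) e2
  have near : ∀ x w R : F, l • (x - w) = R → ‖w‖ ≤ ρ → ‖R‖ ≤ ρ * M → ‖x‖ ≤ ε := by
    intro x w R hx hw hR
    rw [← hx, norm_smul, Real.norm_of_nonneg hl0.le] at hR
    have : ‖x - w‖ ≤ ρ * (M / l) := by
      rw [← mul_div_assoc, le_div_iff₀ hl0]; linarith
    have := norm_sub_norm_le x w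
    nlinarith
  refine ⟨h, hh, k, hk, P, Q, S₁, S₂, near _ _ _ g1 hz1 hP1, near _ _ _ g2 hz2 hP2,
    by nlinarith, by nlinarith, fun γ hγ => ?_, fun γ hγ => ?_, s1, s2, fun a b => ?_⟩
  · filter_upwards [e1.def hγ] with a ha haK
    have := hU'.upper_bound hzh haK
    rw [Real.norm_eq_abs, Real.norm_of_nonneg (by positivity)] at ha
    linarith [(abs_le.1 ha).2]
  · filter_upwards [e2.def hγ] with a ha haK
    have := hV'.upper_bound hzk haK
    rw [Real.norm_eq_abs, Real.norm_of_nonneg (by positivity)] at ha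
    linarith [(abs_le.1 ha).2]
  · have hR := ((isLittleO_along_ray e1 a).add (isLittleO_along_ray e2 b)).neg_left
    have := (nonneg_of_quadratic_nonneg (A := 0) (B := l / 2 * ‖a - b‖ ^ 2
      + δ * (‖a‖ ^ 2 + ‖b‖ ^ 2) - 1 / 2 * (⟪S₁ a, a⟫ + ⟪S₂ b, b⟫)) hR fun t ht => ?_).2 rfl
    · rw [hδ] at this
      linarith
    · have := hcon (z + (i₁ (t • a) + i₂ (t • b)))
      rw [add_sub_cancel_left] at this
      simp only [W, ip, WithLp.add_fst, WithLp.add_snd, i11, i12, i21, i22, add_zero, zero_add,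
        add_sub_add_comm, norm_add_sq_real, ← smul_sub, inner_smul_right, norm_smul, mul_pow,
        Real.norm_eq_abs, sq_abs] at this
      simp only [map_smul, real_inner_smul_left, inner_smul_right, P, Q, inner_add_left,
        inner_sub_left, inner_sub_right] at this ⊢
      linarith

/-- The symmetric matrix representing the quadratic form `a ↦ ⟪S a, a⟫`. -/
def symMatrix {n : ℕ} (S : En n →L[ℝ] En n) : Symn n :=
  Matrix.of fun i j => 1 / 2 * (⟪S (EuclideanSpace.single i 1), EuclideanSpace.single j 1⟫ +
    ⟪S (EuclideanSpace.single j 1), EuclideanSpace.single i 1⟫)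

theorem symMatrix_isSymm {n : ℕ} (S : En n →L[ℝ] En n) : (symMatrix S).IsSymm := by
  ext i j
  simp only [symMatrix, Matrix.transpose_apply, Matrix.of_apply]
  ring

theorem dotProduct_symMatrix_mulVec {n : ℕ} (S : En n →L[ℝ] En n) (a : En n) :
    a ⬝ᵥ symMatrix S *ᵥ a = ⟪S a, a⟫ := by
  have ha : a = ∑ i, a i • (EuclideanSpace.single i 1 : En n) := by
    simpa using ((EuclideanSpace.basisFun (Fin n) ℝ).sum_repr a).symm
  have h1 : ⟪S a, a⟫ = ∑ i, ∑ j, a i * a j *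
      ⟪S (EuclideanSpace.single j 1), (EuclideanSpace.single i 1 : En n)⟫ := by
    conv_lhs => rw [ha]
    simp only [map_sum, map_smul, sum_inner, inner_sum, inner_smul_left, inner_smul_right,
      conj_trivial]
    refine Finset.sum_congr rfl fun i _ => ?_
    rw [Finset.mul_sum]
    exact Finset.sum_congr rfl fun j _ => by ring
  have h2 : ⟪S a, a⟫ = ∑ i, ∑ j, a i * a j *
      ⟪S (EuclideanSpace.single i 1), (EuclideanSpace.single j 1 : En n)⟫ := by
    refine h1.trans (Finset.sum_comm.trans ?_)
    exact Finset.sum_congr rfl fun i _ => Finset.sum_congr rfl fun j _ => by ring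
  have h3 : a ⬝ᵥ symMatrix S *ᵥ a = 1 / 2 * (⟪S a, a⟫ + ⟪S a, a⟫) := by
    nth_rewrite 1 [h1]
    rw [h2, ← Finset.sum_add_distrib, Finset.mul_sum]
    simp only [dotProduct, Matrix.mulVec, symMatrix, Matrix.of_apply, Finset.mul_sum,
      ← Finset.sum_add_distrib]
    exact Finset.sum_congr rfl fun i _ => Finset.sum_congr rfl fun j _ => by ring
  linarith

theorem abs_apply_le_of_quadratic_bound {n : ℕ} {X : Symn n} (hX : X.IsSymm) {C : ℝ}
    (h : ∀ a : En n, |a ⬝ᵥ X *ᵥ a| ≤ C * ‖a‖ ^ 2) (i j : Fin n) : |X i j| ≤ 2 * C := by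
  set e : En n := EuclideanSpace.single i 1
  set f : En n := EuclideanSpace.single j 1
  have hpol : 4 * X i j =
      (e + f).ofLp ⬝ᵥ X *ᵥ (e + f).ofLp - (e - f).ofLp ⬝ᵥ X *ᵥ (e - f).ofLp := by
    have h1 : e ⬝ᵥ X *ᵥ f = X i j := by simp [e, f]
    have h2 : f ⬝ᵥ X *ᵥ e = X i j := by simp [e, f]; exact hX.apply i j
    simp only [WithLp.ofLp_add, WithLp.ofLp_sub, Matrix.mulVec_add, Matrix.mulVec_sub,
      add_dotProduct, dotProduct_add,
      sub_dotProduct, dotProduct_sub, h1, h2]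
    ring
  have he : ‖e‖ = 1 := by simp [e]
  have hf : ‖f‖ = 1 := by simp [f]
  have hpar : ‖e + f‖ ^ 2 + ‖e - f‖ ^ 2 = 4 := by
    have := parallelogram_law_with_norm ℝ e f
    rw [he, hf] at this
    nlinarith
  have h1 := abs_le.1 (h (e + f))
  have h2 := abs_le.1 (h (e - f))
  rw [abs_le]
  constructor <;> nlinarith

/-- The points, gradients and Hessians of test functions touching `u` from above. -/
def jetAbove {n : ℕ} (Ω : Set (En n)) (u : En n → ℝ) : Set (En n × En n × Symn n) :=
  {q | q.1 ∈ Ω ∧ q.2.2.IsSymm ∧ ∃ φ : En n → ℝ, ContDiff ℝ 2 φ ∧ TouchAbove Ω φ u q.1 ∧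
    gradient φ q.1 = q.2.1 ∧ hess φ q.1 = q.2.2}

theorem exists_quadratic_test {n : ℕ} (x p : En n) (S : En n →L[ℝ] En n) (c : ℝ) :
    ∃ φ : En n → ℝ, ContDiff ℝ 2 φ ∧
      (∀ y, φ y = c + ⟪p, y - x⟫ + 1 / 2 * ⟪S (y - x), y - x⟫) ∧
      gradient φ x = p ∧ hess φ x = symMatrix S := by
  refine ⟨fun y => c + ⟪p, y - x⟫ + 1 / 2 * ⟪S (y - x), y - x⟫, ?_, fun _ => rfl, ?_, ?_⟩
  · have h1 : ContDiff ℝ 2 fun y : En n => y - x := contDiff_id.sub contDiff_const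
    exact (contDiff_const.add (contDiff_const.inner ℝ h1)).add
      (contDiff_const.mul ((S.contDiff.comp h1).inner ℝ h1))
  all_goals
    have hd : ∀ z, HasFDerivAt (fun y => c + ⟪p, y - x⟫ + 1 / 2 * ⟪S (y - x), y - x⟫)
        (innerSL ℝ p + (1 / 2 : ℝ) • (innerSL ℝ (S (z - x)) +
          (innerSL ℝ (z - x)).comp S)) z := by
      intro z
      have h1 : HasFDerivAt (fun y : En n => y - x) (ContinuousLinearMap.id ℝ (En n)) z :=
        (hasFDerivAt_id z).sub_const x
      have h2 : HasFDerivAt (fun y : En n => S (y - x)) S z := S.hasFDerivAt.comp z h1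
      have h3 := (((innerSL ℝ p).hasFDerivAt.comp z h1).const_add c).add
        ((h2.inner ℝ h1).const_mul (1 / 2 : ℝ))
      refine h3.congr_fderiv ?_
      ext a
      simp only [_root_.add_apply, _root_.smul_apply, ContinuousLinearMap.comp_apply,
        ContinuousLinearMap.id_apply, innerSL_apply_apply, ContinuousLinearMap.prod_apply,
        fderivInnerCLM_apply, smul_eq_mul]
      rw [real_inner_comm (z - x) (S a)]
  · have := hd x
    simp only [sub_self, map_zero, ContinuousLinearMap.zero_comp, add_zero, smul_zero] at this
    refine HasGradientAt.gradient ?_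
    rw [hasGradientAt_iff_hasFDerivAt]
    exact this
  · ext i j
    simp only [hess, Matrix.of_apply, symMatrix]
    rw [iteratedFDeriv_two_apply]
    have h1 : fderiv ℝ (fun y => c + ⟪p, y - x⟫ + 1 / 2 * ⟪S (y - x), y - x⟫) = fun z =>
        innerSL ℝ p + (1 / 2 : ℝ) • (innerSL ℝ (S (z - x)) + (innerSL ℝ (z - x)).comp S) :=
      funext fun z => (hd z).fderiv
    rw [h1]
    set e : En n := EuclideanSpace.single i 1
    set f : En n := EuclideanSpace.single j 1
    have h2 : HasFDerivAt (fun z : En n => innerSL ℝ p + (1 / 2 : ℝ) • (innerSL ℝ (S (z - x)) +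
        (innerSL ℝ (z - x)).comp S)) (fderiv ℝ (fun z : En n => innerSL ℝ p + (1 / 2 : ℝ) •
        (innerSL ℝ (S (z - x)) + (innerSL ℝ (z - x)).comp S)) x) x := by
      apply DifferentiableAt.hasFDerivAt
      have h1 : DifferentiableAt ℝ (fun z : En n => z - x) x := by fun_prop
      have h2 : DifferentiableAt ℝ (fun z : En n => innerSL ℝ (S (z - x))) x :=
        (innerSL ℝ).differentiableAt.comp x (S.differentiableAt.comp x h1)
      have h3 : DifferentiableAt ℝ (fun z : En n => innerSL ℝ (z - x)) x :=
        (innerSL ℝ).differentiableAt.comp x h1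
      exact (((h2.fun_add (h3.clm_comp (differentiableAt_const S))).fun_const_smul _).const_add _)
    have h3 := h2.clm_apply (hasFDerivAt_const f x)
    have h4 : HasFDerivAt (fun z : En n => ⟪p, f⟫ + 1 / 2 * (⟪S (z - x), f⟫ + ⟪z - x, S f⟫))
      ((1 / 2 : ℝ) • ((innerSL ℝ f).comp S + innerSL ℝ (S f))) x := by
      have h1 : HasFDerivAt (fun y : En n => y - x) (ContinuousLinearMap.id ℝ (En n)) x :=
        (hasFDerivAt_id x).sub_const x
      have h2 : HasFDerivAt (fun y : En n => S (y - x)) S x := S.hasFDerivAt.comp x h1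
      have h5 := (((h2.inner ℝ (hasFDerivAt_const f x)).add
        (h1.inner ℝ (hasFDerivAt_const (S f) x))).const_mul (1 / 2 : ℝ)).const_add ⟪p, f⟫
      refine h5.congr_fderiv ?_
      ext a
      simp [real_inner_comm]
    have h6 := congrArg (fun A => A e) (h3.unique h4)
    simp at h6
    simp only [Matrix.cons_val_zero, Matrix.cons_val_one]
    simp
    rw [h6, real_inner_comm f, real_inner_comm e]
    ring

theorem mem_jetAbove_of_second_order {n : ℕ} {Ω : Set (En n)} {u : En n → ℝ} {x p : En n}
    {S : En n →L[ℝ] En n} (hx : x ∈ Ω) {ε : ℝ} (hε : 0 < ε)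
    (h : ∀ γ > 0, ∀ᶠ a in 𝓝 0, x + a ∈ Ω →
      u (x + a) ≤ u x + ⟪p, a⟫ + 1 / 2 * ⟪S a, a⟫ + γ * ‖a‖ ^ 2) :
    (x, p, symMatrix (S + ε • ContinuousLinearMap.id ℝ (En n))) ∈ jetAbove Ω u := by
  obtain ⟨φ, hφ, hφe, hg, hh⟩ :=
    exists_quadratic_test x p (S + ε • ContinuousLinearMap.id ℝ (En n)) (u x)
  refine ⟨hx, symMatrix_isSymm _, φ, hφ, ⟨by simp [hφe], ?_⟩, hg, hh⟩
  obtain ⟨r, hr, hball⟩ := Metric.eventually_nhds_iff.1 (h (ε / 4) (by positivity))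
  refine ⟨Metric.ball x r, Metric.isOpen_ball, Metric.mem_ball_self hr, ?_⟩
  rintro y ⟨⟨hy, hyΩ⟩, hne⟩
  have h1 := hball (y := y - x) (by simpa [dist_eq_norm] using hy) (by simpa using hyΩ)
  have h2 : 0 < ‖y - x‖ ^ 2 := by
    have := norm_pos_iff.2 (sub_ne_zero.2 hne)
    positivity
  rw [add_sub_cancel] at h1
  rw [hφe]
  simp only [_root_.add_apply, _root_.smul_apply, ContinuousLinearMap.id_apply,
    inner_add_left, inner_smul_left, conj_trivial, real_inner_self_eq_norm_sq]
  nlinarith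

theorem mem_jetAbove_of_translate {n : ℕ} {Ω : Set (En n)} {u U : En n → ℝ} {x₀ P h p : En n}
    {S : En n →L[ℝ] En n} {c : ℝ} (hU : ∀ a, U a = u (x₀ + a) - c - ⟪P, a⟫) (hx : x₀ + h ∈ Ω)
    {ε : ℝ} (hε : 0 < ε)
    (hS : ∀ γ > 0, ∀ᶠ a in 𝓝 0, h + a ∈ (fun z => x₀ + z) ⁻¹' closure Ω →
      U (h + a) ≤ U h + ⟪p, a⟫ + 1 / 2 * ⟪S a, a⟫ + γ * ‖a‖ ^ 2) :
    (x₀ + h, P + p, symMatrix (S + ε • ContinuousLinearMap.id ℝ (En n))) ∈ jetAbove Ω u := by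
  refine mem_jetAbove_of_second_order hx hε fun γ hγ => ?_
  filter_upwards [hS γ hγ] with a ha hmem
  have h1 := ha (subset_closure (by simpa [add_assoc] using hmem))
  rw [hU, hU, inner_add_right, ← add_assoc] at h1
  rw [inner_add_left]
  linarith

theorem exists_jets_of_doubled_max {n : ℕ} {Ω : Set (En n)} (hΩo : IsOpen Ω) (hΩb : IsBounded Ω)
    {u w : En n → ℝ} (hu : ContinuousOn u (closure Ω)) (hw : ContinuousOn w (closure Ω))
    {x₀ y₀ : En n} (hx₀ : x₀ ∈ Ω) (hy₀ : y₀ ∈ Ω) {α : ℝ} (hα : 0 < α)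
    (hmax : ∀ x ∈ closure Ω, ∀ y ∈ closure Ω,
      u x + w y - α / 2 * ‖x - y‖ ^ 2 ≤ u x₀ + w y₀ - α / 2 * ‖x₀ - y₀‖ ^ 2)
    {ε : ℝ} (hε : 0 < ε) :
    ∃ (x p y q : En n) (X Y : Symn n), (x, p, X) ∈ jetAbove Ω u ∧ (y, q, Y) ∈ jetAbove Ω w ∧
      ‖x - x₀‖ ≤ ε ∧ ‖p - α • (x₀ - y₀)‖ ≤ ε ∧ ‖y - y₀‖ ≤ ε ∧ ‖q - -(α • (x₀ - y₀))‖ ≤ ε ∧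
      (∀ a : En n, -(3 * α) * ‖a‖ ^ 2 ≤ a ⬝ᵥ X *ᵥ a) ∧
      (∀ a : En n, -(3 * α) * ‖a‖ ^ 2 ≤ a ⬝ᵥ Y *ᵥ a) ∧
      ∀ a b : En n, a ⬝ᵥ X *ᵥ a + b ⬝ᵥ Y *ᵥ b ≤
        3 * α * ‖a - b‖ ^ 2 + ε * (‖a‖ ^ 2 + ‖b‖ ^ 2) := by
  set P : En n := α • (x₀ - y₀) with hP
  obtain ⟨r, hr, hrx⟩ := Metric.isOpen_iff.1 hΩo x₀ hx₀
  obtain ⟨s, hs, hsy⟩ := Metric.isOpen_iff.1 hΩo y₀ hy₀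
  set K : En n → Set (En n) := fun z => (fun h => z + h) ⁻¹' closure Ω
  have hK : ∀ z, IsCompact (K z) := fun z =>
    (Homeomorph.addLeft z).isCompact_preimage.2 hΩb.isCompact_closure
  have hcont : ∀ z, ContinuousOn (fun h => z + h) (K z) := fun z => by fun_prop
  set δ := min (ε / 2) (min (r / 2) (s / 2))
  have hδ : 0 < δ := by positivity
  have hδε : δ ≤ ε / 2 := min_le_left _ _
  have hδr : δ < r := ((min_le_right _ _).trans (min_le_left _ _)).trans_lt (by linarith)
  have hδs : δ < s := ((min_le_right _ _).trans (min_le_right _ _)).trans_lt (by linarith)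
  obtain ⟨h, -, k, -, p, q, S, T, hh, hk, hp, hq, hS, hT, hS', hT', hST⟩ :=
    exists_approx_jets (K₁ := K x₀) (K₂ := K y₀) (hK x₀) (hK y₀)
      (by simpa [K] using subset_closure hx₀) (by simpa [K] using subset_closure hy₀)
      (U := fun h => u (x₀ + h) - u x₀ - ⟪P, h⟫) (V := fun k => w (y₀ + k) - w y₀ - ⟪-P, k⟫)
      (((hu.comp (hcont x₀) fun _ => id).sub continuousOn_const).sub
        (by fun_prop : Continuous fun h : En n => ⟪P, h⟫).continuousOn)
      (((hw.comp (hcont y₀) fun _ => id).sub continuousOn_const).sub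
        (by fun_prop : Continuous fun h : En n => ⟪-P, h⟫).continuousOn)
      (by simp) (by simp) hα (fun x hx y hy => by
        have h1 := hmax _ hx _ hy
        have h2 : x₀ + x - (y₀ + y) = (x₀ - y₀) + (x - y) := by abel
        rw [h2, norm_add_sq_real] at h1
        have h3 : ⟪P, x⟫ + ⟪-P, y⟫ = α * ⟪x₀ - y₀, x - y⟫ := by
          rw [inner_neg_left, hP, inner_smul_left, inner_smul_left, inner_sub_right]
          simp only [conj_trivial]
          ring
        nlinarith) hδ
  have hform : ∀ (R : En n →L[ℝ] En n) (a : En n),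
      a ⬝ᵥ symMatrix (R + δ • ContinuousLinearMap.id ℝ (En n)) *ᵥ a =
        ⟪R a, a⟫ + δ * ‖a‖ ^ 2 := fun R a => by
    rw [dotProduct_symMatrix_mulVec]
    simp [inner_add_left, inner_smul_left]
  refine ⟨x₀ + h, P + p, y₀ + k, -P + q, symMatrix (S + δ • ContinuousLinearMap.id ℝ (En n)),
    symMatrix (T + δ • ContinuousLinearMap.id ℝ (En n)),
    mem_jetAbove_of_translate (fun _ => rfl) (hrx (by simpa using hh.trans_lt hδr)) hδ hS,
    mem_jetAbove_of_translate (fun _ => rfl) (hsy (by simpa using hk.trans_lt hδs)) hδ hT,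
    ?_, ?_, ?_, ?_, ?_, ?_, ?_⟩
  · rw [add_sub_cancel_left]; linarith
  · rw [add_sub_cancel_left]; linarith
  · rw [add_sub_cancel_left]; linarith
  · rw [add_sub_cancel_left]; linarith
  · intro a
    rw [hform]
    have := hS' a
    have : 0 ≤ δ * ‖a‖ ^ 2 := by positivity
    linarith
  · intro a
    rw [hform]
    have := hT' a
    have : 0 ≤ δ * ‖a‖ ^ 2 := by positivity
    linarith
  · intro a b
    rw [hform, hform]
    have := hST a b
    have : δ * (‖a‖ ^ 2 + ‖b‖ ^ 2) ≤ ε / 2 * (‖a‖ ^ 2 + ‖b‖ ^ 2) := by gcongr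
    linarith

theorem dotProduct_fromBlocks_mulVec {n : ℕ} (A B C D : Symn n) (z : Fin n ⊕ Fin n → ℝ) :
    z ⬝ᵥ Matrix.fromBlocks A B C D *ᵥ z =
      (z ∘ Sum.inl) ⬝ᵥ A *ᵥ (z ∘ Sum.inl) + (z ∘ Sum.inl) ⬝ᵥ B *ᵥ (z ∘ Sum.inr) +
        ((z ∘ Sum.inr) ⬝ᵥ C *ᵥ (z ∘ Sum.inl) + (z ∘ Sum.inr) ⬝ᵥ D *ᵥ (z ∘ Sum.inr)) := by
  rw [Matrix.fromBlocks_mulVec]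
  conv_lhs => rw [← Sum.elim_comp_inl_inr z]
  rw [sumElim_dotProduct_sumElim, dotProduct_add, dotProduct_add]
  simp

theorem norm_toLp_sq {n : ℕ} (a : Fin n → ℝ) : ‖(WithLp.toLp 2 a : En n)‖ ^ 2 = a ⬝ᵥ a := by
  rw [EuclideanSpace.real_norm_sq_eq]
  simp [dotProduct, sq]

theorem loewnerLE_fromBlocks {n : ℕ} {X Y : Symn n} (hX : X.IsSymm) (hY : Y.IsSymm) {c : ℝ}
    (h1 : ∀ a : En n, -c * ‖a‖ ^ 2 ≤ a ⬝ᵥ X *ᵥ a) (h2 : ∀ a : En n, -c * ‖a‖ ^ 2 ≤ a ⬝ᵥ Y *ᵥ a) :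
    LoewnerLE ((-c) • (1 : Matrix (Fin n ⊕ Fin n) (Fin n ⊕ Fin n) ℝ))
      (Matrix.fromBlocks X 0 0 Y) := by
  rw [← Matrix.fromBlocks_one, Matrix.fromBlocks_smul]
  unfold LoewnerLE
  rw [sub_eq_add_neg, Matrix.fromBlocks_neg, Matrix.fromBlocks_add]
  refine Matrix.PosSemidef.of_dotProduct_mulVec_nonneg ?_ fun z => ?_
  · rw [Matrix.IsHermitian, Matrix.conjTranspose_eq_transpose_of_trivial]
    simp [Matrix.fromBlocks_transpose, hX.eq, hY.eq]
  · rw [star_trivial, dotProduct_fromBlocks_mulVec]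
    have e1 := h1 (WithLp.toLp 2 (z ∘ Sum.inl))
    have e2 := h2 (WithLp.toLp 2 (z ∘ Sum.inr))
    rw [norm_toLp_sq] at e1 e2
    simp [Matrix.add_mulVec, Matrix.smul_mulVec] at e1 e2 ⊢
    linarith

theorem fromBlocks_loewnerLE {n : ℕ} {X Y : Symn n} (hX : X.IsSymm) (hY : Y.IsSymm) {c : ℝ}
    (h : ∀ a b : En n, a ⬝ᵥ X *ᵥ a + b ⬝ᵥ Y *ᵥ b ≤ c * ‖a - b‖ ^ 2) :
    LoewnerLE (Matrix.fromBlocks X 0 0 Y) (c • Matrix.fromBlocks 1 (-1) (-1) (1 : Symn n)) := by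
  rw [Matrix.fromBlocks_smul]
  unfold LoewnerLE
  rw [sub_eq_add_neg, Matrix.fromBlocks_neg, Matrix.fromBlocks_add]
  refine Matrix.PosSemidef.of_dotProduct_mulVec_nonneg ?_ fun z => ?_
  · rw [Matrix.IsHermitian, Matrix.conjTranspose_eq_transpose_of_trivial]
    simp [Matrix.fromBlocks_transpose, hX.eq, hY.eq]
  · rw [star_trivial, dotProduct_fromBlocks_mulVec]
    have e := h (WithLp.toLp 2 (z ∘ Sum.inl)) (WithLp.toLp 2 (z ∘ Sum.inr))
    rw [← WithLp.toLp_sub, norm_toLp_sq] at e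
    simp [Matrix.add_mulVec, Matrix.neg_mulVec, Matrix.smul_mulVec, sub_dotProduct,
      dotProduct_comm (z ∘ Sum.inr) (z ∘ Sum.inl)] at e ⊢
    linarith

theorem exists_limiting_jets_of_doubled_max {n : ℕ} {Ω : Set (En n)} (hΩo : IsOpen Ω)
    (hΩb : IsBounded Ω) {u w : En n → ℝ} (hu : ContinuousOn u (closure Ω))
    (hw : ContinuousOn w (closure Ω)) {x₀ y₀ : En n} (hx₀ : x₀ ∈ Ω) (hy₀ : y₀ ∈ Ω) {α : ℝ}
    (hα : 0 < α)
    (hmax : ∀ x ∈ closure Ω, ∀ y ∈ closure Ω,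
      u x + w y - α / 2 * ‖x - y‖ ^ 2 ≤ u x₀ + w y₀ - α / 2 * ‖x₀ - y₀‖ ^ 2) :
    ∃ X Y : Symn n, X.IsSymm ∧ Y.IsSymm ∧
      LoewnerLE ((-(3 * α)) • (1 : Matrix (Fin n ⊕ Fin n) (Fin n ⊕ Fin n) ℝ))
        (Matrix.fromBlocks X 0 0 Y) ∧
      LoewnerLE (Matrix.fromBlocks X 0 0 Y)
        ((3 * α) • Matrix.fromBlocks 1 (-1) (-1) (1 : Symn n)) ∧
      (x₀, α • (x₀ - y₀), X) ∈ closure (jetAbove Ω u) ∧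
      (y₀, -(α • (x₀ - y₀)), Y) ∈ closure (jetAbove Ω w) := by
  have hε : ∀ k : ℕ, 0 < 1 / ((k : ℝ) + 1) := fun k => by positivity
  have hε1 : ∀ k : ℕ, 1 / ((k : ℝ) + 1) ≤ 1 := fun k => by
    rw [div_le_one (by positivity)]
    linarith [(Nat.cast_nonneg k : (0 : ℝ) ≤ k)]
  choose x p y q X Y hXj hYj hx hp hy hq hXl hYl hXY using fun k : ℕ =>
    exists_jets_of_doubled_max hΩo hΩb hu hw hx₀ hy₀ hα hmax (hε k)
  set l : Filter ℕ := (hyperfilter ℕ : Filter ℕ)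
  have hlim : Tendsto (fun k : ℕ => 1 / ((k : ℝ) + 1)) l (𝓝 0) :=
    tendsto_one_div_add_atTop_nhds_zero_nat.mono_left Nat.hyperfilter_le_atTop
  have hconv : ∀ {z : ℕ → En n} {z₀ : En n}, (∀ k, ‖z k - z₀‖ ≤ 1 / ((k : ℝ) + 1)) →
      Tendsto z l (𝓝 z₀) := fun h =>
    tendsto_iff_norm_sub_tendsto_zero.2 (squeeze_zero (fun _ => norm_nonneg _) h hlim)
  have hbox : IsCompact (Set.pi Set.univ fun _ : Fin n => Set.pi Set.univ fun _ : Fin n =>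
      Set.Icc (-(2 * (3 * α + 1))) (2 * (3 * α + 1))) :=
    isCompact_univ_pi fun _ => isCompact_univ_pi fun _ => isCompact_Icc
  have hlimit : ∀ {Z : ℕ → Symn n}, (∀ k, (Z k).IsSymm) →
      (∀ k, ∀ a : En n, |a ⬝ᵥ Z k *ᵥ a| ≤ (3 * α + 1) * ‖a‖ ^ 2) →
      ∃ Z₀ : Symn n, Tendsto Z l (𝓝 Z₀) ∧ Z₀.IsSymm := by
    intro Z hZ hb
    obtain ⟨Z₀, -, hZ₀⟩ := hbox.ultrafilter_le_nhds' ((hyperfilter ℕ).map Z)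
      (Filter.mem_map.2 (Filter.univ_mem' fun k i _ j _ =>
        abs_le.1 (abs_apply_le_of_quadratic_bound (hZ k) (hb k) i j)))
    have hT : Tendsto Z l (𝓝 Z₀) := hZ₀
    refine ⟨Z₀, hT, ?_⟩
    have h1 : Tendsto (fun k => (Z k)ᵀ) l (𝓝 (Matrix.transpose Z₀)) :=
      (continuous_id.matrix_transpose.tendsto Z₀).comp hT
    refine tendsto_nhds_unique h1 (hT.congr fun k => (hZ k).eq.symm)
  have hXu : ∀ k, ∀ a : En n, |a ⬝ᵥ X k *ᵥ a| ≤ (3 * α + 1) * ‖a‖ ^ 2 := fun k a => by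
    have h1 := hXY k a 0
    have h2 := hXl k a
    have h3 := mul_le_mul_of_nonneg_right (hε1 k) (sq_nonneg ‖a‖)
    simp at h1 h3
    rw [abs_le]
    constructor <;> nlinarith [sq_nonneg ‖a‖]
  have hYu : ∀ k, ∀ a : En n, |a ⬝ᵥ Y k *ᵥ a| ≤ (3 * α + 1) * ‖a‖ ^ 2 := fun k a => by
    have h1 := hXY k 0 a
    have h2 := hYl k a
    have h3 := mul_le_mul_of_nonneg_right (hε1 k) (sq_nonneg ‖a‖)
    simp at h1 h3
    rw [abs_le]
    constructor <;> nlinarith [sq_nonneg ‖a‖]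
  obtain ⟨X₀, hX₀, hXs⟩ := hlimit (fun k => (hXj k).2.1) hXu
  obtain ⟨Y₀, hY₀, hYs⟩ := hlimit (fun k => (hYj k).2.1) hYu
  have hform : ∀ {Z : ℕ → Symn n} {Z₀ : Symn n}, Tendsto Z l (𝓝 Z₀) → ∀ a : En n,
      Tendsto (fun k => a ⬝ᵥ Z k *ᵥ a) l (𝓝 (a ⬝ᵥ Z₀ *ᵥ a)) := fun {Z Z₀} hZ a => by
    have : Continuous fun M : Symn n => a ⬝ᵥ M *ᵥ a :=
      continuous_const.dotProduct (continuous_id.matrix_mulVec continuous_const)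
    exact (this.tendsto Z₀).comp hZ
  refine ⟨X₀, Y₀, hXs, hYs,
    loewnerLE_fromBlocks hXs hYs (fun a => ge_of_tendsto' (hform hX₀ a) fun k => hXl k a)
      (fun a => ge_of_tendsto' (hform hY₀ a) fun k => hYl k a),
    fromBlocks_loewnerLE hXs hYs fun a b => ?_,
    mem_closure_of_tendsto ((hconv hx).prodMk_nhds ((hconv hp).prodMk_nhds hX₀))
      (Filter.Eventually.of_forall hXj),
    mem_closure_of_tendsto ((hconv hy).prodMk_nhds ((hconv hq).prodMk_nhds hY₀))
      (Filter.Eventually.of_forall hYj)⟩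
  have h1 : Tendsto (fun k : ℕ => 3 * α * ‖a - b‖ ^ 2 + 1 / ((k : ℝ) + 1) * (‖a‖ ^ 2 + ‖b‖ ^ 2)) l
      (𝓝 (3 * α * ‖a - b‖ ^ 2 + 0 * (‖a‖ ^ 2 + ‖b‖ ^ 2))) :=
    (hlim.mul_const _).const_add _
  rw [zero_mul, add_zero] at h1
  exact le_of_tendsto_of_tendsto' ((hform hX₀ a).add (hform hY₀ b)) h1 fun k => hXY k a b

theorem nonneg_of_mem_closure {Q : Type*} [TopologicalSpace Q] {A B : Set Q} {g : Q → ℝ}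
    (hg : ContinuousOn g B) (hAB : A ⊆ B) (h : ∀ q ∈ A, 0 ≤ g q) {q : Q} (hqB : q ∈ B)
    (hq : q ∈ closure A) : 0 ≤ g q := by
  have := mem_closure_iff_nhdsWithin_neBot.1 hq
  exact ge_of_tendsto ((hg q hqB).mono hAB) (eventually_mem_nhdsWithin.mono h)

theorem uEnv_eq {n : ℕ} {Ω : Set (En n)} {f : En n → ℝ} (hf : ContinuousOn f Ω) {x : En n}
    (hx : x ∈ Ω) : uEnv Ω f x = f x := by
  have := mem_closure_iff_nhdsWithin_neBot.1 (subset_closure hx)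
  exact (hf x hx).limsup_eq

theorem lEnv_eq {n : ℕ} {Ω : Set (En n)} {f : En n → ℝ} (hf : ContinuousOn f Ω) {x : En n}
    (hx : x ∈ Ω) : lEnv Ω f x = f x := by
  have := mem_closure_iff_nhdsWithin_neBot.1 (subset_closure hx)
  exact (hf x hx).liminf_eq

theorem TouchAbove.uEnv {n : ℕ} {Ω : Set (En n)} {f φ : En n → ℝ} (hf : ContinuousOn f Ω)
    {x : En n} (hx : x ∈ Ω) (h : TouchAbove Ω φ f x) : TouchAbove Ω φ (uEnv Ω f) x := by
  obtain ⟨h1, N, hN, hxN, h2⟩ := h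
  exact ⟨h1.trans (uEnv_eq hf hx).symm, N, hN, hxN, fun y hy =>
    (uEnv_eq hf hy.1.2).trans_lt (h2 y hy)⟩

theorem TouchAbove.neg_lEnv {n : ℕ} {Ω : Set (En n)} {f φ : En n → ℝ} (hf : ContinuousOn f Ω)
    {x : En n} (hx : x ∈ Ω) (h : TouchAbove Ω φ (-f) x) : TouchBelow Ω (-φ) (lEnv Ω f) x := by
  obtain ⟨h1, N, hN, hxN, h2⟩ := h
  refine ⟨?_, N, hN, hxN, fun y hy => ?_⟩
  · rw [lEnv_eq hf hx, Pi.neg_apply, h1, Pi.neg_apply, neg_neg]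
  · rw [lEnv_eq hf hy.1.2, Pi.neg_apply]
    have := h2 y hy
    rw [Pi.neg_apply] at this
    linarith

theorem gradient_neg_apply {n : ℕ} (φ : En n → ℝ) (x : En n) :
    gradient (-φ) x = -gradient φ x := by
  simp [gradient, fderiv_neg]

theorem hess_neg_apply {n : ℕ} (φ : En n → ℝ) (x : En n) : hess (-φ) x = -hess φ x := by
  ext i j
  simp [hess, iteratedFDeriv_neg_apply]

/-- `f` is a continuous viscosity solution of the scalar equation with operator `G`, in which the
zeroth order arguments are frozen along `(w₁, w₂)`. -/
structure IsComponentSolution {n m₁ m₂ : ℕ} (Ω : Set (En n)) (G : Op n m₁ m₂)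
    (w₁ : En n → Fin m₁ → ℝ) (w₂ : En n → Fin m₂ → ℝ) (f : En n → ℝ) : Prop where
  le_zero : ∀ q ∈ jetAbove Ω f, G q.1 (w₁ q.1) (w₂ q.1) q.2.1 q.2.2 ≤ 0
  zero_le : ∀ q ∈ jetAbove Ω (-f), 0 ≤ G q.1 (w₁ q.1) (w₂ q.1) (-q.2.1) (-q.2.2)

section ComponentSolution

variable {n m₁ m₂ : ℕ} {Ω : Set (En n)} {F1 : Fin m₁ → Op n m₁ m₂} {F2 : Fin m₂ → Op n m₁ m₂}
  {w₁ : En n → Fin m₁ → ℝ} {w₂ : En n → Fin m₂ → ℝ}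

theorem isComponentSolution_fst (h₁ : ContinuousOn w₁ Ω) (h₂ : ContinuousOn w₂ Ω)
    (hs : SuperSub Ω F1 F2 w₁ w₂) (hs' : SubSuper Ω F1 F2 w₁ w₂) (j : Fin m₁) :
    IsComponentSolution Ω (F1 j) w₁ w₂ fun x => w₁ x j := by
  have c₁ : ∀ i, ContinuousOn (fun y => w₁ y i) Ω := fun i =>
    (continuous_apply i).comp_continuousOn h₁
  have c₂ : ∀ i, ContinuousOn (fun y => w₂ y i) Ω := fun i =>
    (continuous_apply i).comp_continuousOn h₂
  constructor
  · rintro ⟨x, p, X⟩ ⟨hx, -, φ, hφ, ht, hp, hX⟩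
    dsimp only at hx ht hp hX ⊢
    subst hp hX
    have := hs'.2.2.1 j x hx φ hφ (ht.uEnv (c₁ j) hx)
    rwa [funext fun i => uEnv_eq (c₁ i) hx, funext fun i => lEnv_eq (c₂ i) hx] at this
  · rintro ⟨x, p, X⟩ ⟨hx, -, φ, hφ, ht, hp, hX⟩
    dsimp only at hx ht hp hX ⊢
    subst hp hX
    have := hs.2.2.1 j x hx (-φ) hφ.neg (ht.neg_lEnv (c₁ j) hx)
    rwa [funext fun i => lEnv_eq (c₁ i) hx, funext fun i => uEnv_eq (c₂ i) hx,
      gradient_neg_apply, hess_neg_apply] at this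

theorem isComponentSolution_snd (h₁ : ContinuousOn w₁ Ω) (h₂ : ContinuousOn w₂ Ω)
    (hs : SuperSub Ω F1 F2 w₁ w₂) (hs' : SubSuper Ω F1 F2 w₁ w₂) (j : Fin m₂) :
    IsComponentSolution Ω (F2 j) w₁ w₂ fun x => w₂ x j := by
  have c₁ : ∀ i, ContinuousOn (fun y => w₁ y i) Ω := fun i =>
    (continuous_apply i).comp_continuousOn h₁
  have c₂ : ∀ i, ContinuousOn (fun y => w₂ y i) Ω := fun i =>
    (continuous_apply i).comp_continuousOn h₂
  constructor
  · rintro ⟨x, p, X⟩ ⟨hx, -, φ, hφ, ht, hp, hX⟩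
    dsimp only at hx ht hp hX ⊢
    subst hp hX
    have := hs.2.2.2 j x hx φ hφ (ht.uEnv (c₂ j) hx)
    rwa [funext fun i => lEnv_eq (c₁ i) hx, funext fun i => uEnv_eq (c₂ i) hx] at this
  · rintro ⟨x, p, X⟩ ⟨hx, -, φ, hφ, ht, hp, hX⟩
    dsimp only at hx ht hp hX ⊢
    subst hp hX
    have := hs'.2.2.2 j x hx (-φ) hφ.neg (ht.neg_lEnv (c₂ j) hx)
    rwa [funext fun i => uEnv_eq (c₁ i) hx, funext fun i => lEnv_eq (c₂ i) hx,
      gradient_neg_apply, hess_neg_apply] at this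

end ComponentSolution

/-- The comparison of two component solutions at a maximum of the doubled functional. -/
theorem IsComponentSolution.exists_matrices {n m₁ m₂ : ℕ} {Ω : Set (En n)} (hΩo : IsOpen Ω)
    (hΩb : IsBounded Ω) {G : Op n m₁ m₂} (hG : OpContinuousOn Ω G)
    {u₁ v₁ : En n → Fin m₁ → ℝ} {u₂ v₂ : En n → Fin m₂ → ℝ} {f g : En n → ℝ}
    (hu₁ : ContinuousOn u₁ Ω) (hu₂ : ContinuousOn u₂ Ω)
    (hv₁ : ContinuousOn v₁ Ω) (hv₂ : ContinuousOn v₂ Ω)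
    (hf : ContinuousOn f (closure Ω)) (hg : ContinuousOn g (closure Ω))
    (hfs : IsComponentSolution Ω G u₁ u₂ f) (hgs : IsComponentSolution Ω G v₁ v₂ g)
    {x₀ y₀ : En n} (hx₀ : x₀ ∈ Ω) (hy₀ : y₀ ∈ Ω) {α : ℝ} (hα : 0 < α)
    (hmax : ∀ x ∈ closure Ω, ∀ y ∈ closure Ω,
      f x - g y - α / 2 * ‖x - y‖ ^ 2 ≤ f x₀ - g y₀ - α / 2 * ‖x₀ - y₀‖ ^ 2) :
    ∃ X Y : Symn n, X.IsSymm ∧ Y.IsSymm ∧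
      LoewnerLE ((-(3 * α)) • (1 : Matrix (Fin n ⊕ Fin n) (Fin n ⊕ Fin n) ℝ))
        (Matrix.fromBlocks X 0 0 Y) ∧
      LoewnerLE (Matrix.fromBlocks X 0 0 Y)
        ((3 * α) • Matrix.fromBlocks 1 (-1) (-1) (1 : Symn n)) ∧
      G x₀ (u₁ x₀) (u₂ x₀) (α • (x₀ - y₀)) X ≤ 0 ∧
      0 ≤ G y₀ (v₁ y₀) (v₂ y₀) (α • (x₀ - y₀)) (-Y) := by
  obtain ⟨X, Y, hX, hY, hl, hr, hXj, hYj⟩ :=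
    exists_limiting_jets_of_doubled_max hΩo hΩb hf hg.neg hx₀ hy₀ hα
      (fun x hx y hy => by simpa only [Pi.neg_apply, ← sub_eq_add_neg] using hmax x hx y hy)
  refine ⟨X, Y, hX, hY, hl, hr, ?_, ?_⟩
  · have hc : ContinuousOn (fun q : En n × En n × Symn n =>
        -G q.1 (u₁ q.1) (u₂ q.1) q.2.1 q.2.2) (Ω ×ˢ Set.univ) := by
      have h1 : ContinuousOn (fun q : En n × En n × Symn n =>
          (q.1, u₁ q.1, u₂ q.1, q.2.1, q.2.2)) (Ω ×ˢ Set.univ) :=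
        continuousOn_fst.prodMk ((hu₁.comp continuousOn_fst fun q hq => hq.1).prodMk
          ((hu₂.comp continuousOn_fst fun q hq => hq.1).prodMk continuousOn_snd))
      exact (hG.comp h1 fun q hq => ⟨hq.1, trivial⟩).neg
    have := nonneg_of_mem_closure hc (fun q hq => ⟨hq.1, trivial⟩)
      (fun q hq => neg_nonneg.2 (hfs.le_zero q hq)) ⟨hx₀, trivial⟩ hXj
    exact neg_nonneg.1 this
  · have hc : ContinuousOn (fun q : En n × En n × Symn n =>
        G q.1 (v₁ q.1) (v₂ q.1) (-q.2.1) (-q.2.2)) (Ω ×ˢ Set.univ) := by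
      have h1 : ContinuousOn (fun q : En n × En n × Symn n =>
          (q.1, v₁ q.1, v₂ q.1, -q.2.1, -q.2.2)) (Ω ×ˢ Set.univ) :=
        continuousOn_fst.prodMk ((hv₁.comp continuousOn_fst fun q hq => hq.1).prodMk
          ((hv₂.comp continuousOn_fst fun q hq => hq.1).prodMk
            (continuous_fst.neg.prodMk continuous_snd.neg |>.comp_continuousOn continuousOn_snd)))
      exact hG.comp h1 fun q hq => ⟨hq.1, trivial⟩
    have := nonneg_of_mem_closure hc (fun q hq => ⟨hq.1, trivial⟩)
      (fun q hq => hgs.zero_le q hq) ⟨hy₀, trivial⟩ hYj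
    simpa using this

section Doubling

variable {E κ : Type*} [NormedAddCommGroup E] [Finite κ] {K : Set E} {A B : κ → E → ℝ}

theorem exists_doubled_max [Nonempty κ] (hK : IsCompact K) (hne : K.Nonempty)
    (hA : ∀ k, ContinuousOn (A k) K) (hB : ∀ k, ContinuousOn (B k) K) (α : ℝ) :
    ∃ k, ∃ x ∈ K, ∃ y ∈ K, ∀ k', ∀ x' ∈ K, ∀ y' ∈ K,
      A k' x' - B k' y' - α / 2 * ‖x' - y'‖ ^ 2 ≤ A k x - B k y - α / 2 * ‖x - y‖ ^ 2 := by
  have h : ∀ k, ∃ z ∈ K ×ˢ K, IsMaxOn (fun z : E × E =>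
      A k z.1 - B k z.2 - α / 2 * ‖z.1 - z.2‖ ^ 2) (K ×ˢ K) z := fun k => by
    refine (hK.prod hK).exists_isMaxOn (hne.prod hne) ?_
    refine (((hA k).comp continuousOn_fst fun z hz => hz.1).sub
      ((hB k).comp continuousOn_snd fun z hz => hz.2)).sub (Continuous.continuousOn ?_)
    fun_prop
  choose z hz hmax using h
  obtain ⟨k, hk⟩ := Finite.exists_max fun k =>
    A k (z k).1 - B k (z k).2 - α / 2 * ‖(z k).1 - (z k).2‖ ^ 2
  exact ⟨k, _, (hz k).1, _, (hz k).2, fun k' x' hx' y' hy' =>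
    (hmax k' (Set.mk_mem_prod hx' hy')).trans (hk k')⟩

theorem exists_uniform_modulus (hK : IsCompact K) (hA : ∀ k, ContinuousOn (A k) K) {η : ℝ}
    (hη : 0 < η) :
    ∃ δ > 0, ∀ k, ∀ x ∈ K, ∀ y ∈ K, ‖x - y‖ < δ → |A k x - A k y| < η := by
  have h : ∀ k, ∀ᶠ δ in 𝓝[>] (0 : ℝ),
      ∀ x ∈ K, ∀ y ∈ K, ‖x - y‖ < δ → |A k x - A k y| < η := fun k => by
    obtain ⟨δ, hδ, h⟩ := Metric.uniformContinuousOn_iff.1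
      (hK.uniformContinuousOn_of_continuous (hA k)) η hη
    filter_upwards [Ioo_mem_nhdsGT hδ] with δ' hδ' x hx y hy hxy
    simpa [dist_eq_norm] using h x hx y hy (by simpa [dist_eq_norm] using hxy.trans hδ'.2)
  obtain ⟨δ, hδ, hδ0⟩ := ((Filter.eventually_all.2 h).and self_mem_nhdsWithin).exists
  exact ⟨δ, hδ0, hδ⟩

/-- For large `α`, maximum points of the doubled functional are interior and nearly diagonal. -/
theorem exists_threshold_doubled_max {Ω : Set E} (hΩ : IsOpen Ω) (hK : IsCompact (closure Ω))
    (hA : ∀ k, ContinuousOn (A k) (closure Ω)) (hB : ∀ k, ContinuousOn (B k) (closure Ω))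
    (hA0 : ∀ k, ∀ x ∈ frontier Ω, A k x = 0) (hB0 : ∀ k, ∀ x ∈ frontier Ω, B k x = 0)
    {M η : ℝ} (hM : 0 < M) (hη : 0 < η) {k₀ : κ} {z : E} (hz : z ∈ Ω)
    (hzM : M ≤ A k₀ z - B k₀ z) :
    ∃ α₀, ∀ α, α₀ ≤ α → ∀ k, ∀ x ∈ closure Ω, ∀ y ∈ closure Ω,
      (∀ k', ∀ x' ∈ closure Ω, ∀ y' ∈ closure Ω,
        A k' x' - B k' y' - α / 2 * ‖x' - y'‖ ^ 2 ≤ A k x - B k y - α / 2 * ‖x - y‖ ^ 2) →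
      α * ‖x - y‖ ^ 2 ≤ η ∧ x ∈ Ω ∧ y ∈ Ω ∧ M ≤ A k x - B k y := by
  obtain ⟨δ₁, hδ₁, hA'⟩ := exists_uniform_modulus hK hA hM
  obtain ⟨δ₂, hδ₂, hB'⟩ := exists_uniform_modulus hK hB (lt_min hM (half_pos hη))
  have hbd : ∃ C, ∀ k, ∀ x ∈ closure Ω, ‖B k x‖ ≤ C := by
    choose C hC using fun k => hK.exists_bound_of_continuousOn (hB k)
    obtain ⟨C', hC'⟩ := (Set.finite_range C).bddAbove
    exact ⟨C', fun k x hx => (hC k x hx).trans (hC' ⟨k, rfl⟩)⟩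
  obtain ⟨C, hC⟩ := hbd
  set δ := min δ₁ δ₂
  have hδ : 0 < δ := lt_min hδ₁ hδ₂
  have hC0 : 0 ≤ C := (norm_nonneg _).trans (hC k₀ z (subset_closure hz))
  refine ⟨(4 * C + 1) / δ ^ 2, fun α hα k x hx y hy hmax => ?_⟩
  have hα0 : 0 < α := lt_of_lt_of_le (by positivity) hα
  have hdiag := hmax k x hx x hx
  have hpen : α * ‖x - y‖ ^ 2 ≤ 2 * |B k x - B k y| := by
    have := le_abs_self (B k x - B k y)
    simp at hdiag
    linarith
  have hclose : ‖x - y‖ < δ := by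
    have h1 : |B k x - B k y| ≤ 2 * C := by
      have h2 := abs_le.1 (hC k x hx)
      have h3 := abs_le.1 (hC k y hy)
      rw [abs_le]
      constructor <;> linarith
    rw [div_le_iff₀ (by positivity)] at hα
    by_contra! hcon
    have : δ ^ 2 ≤ ‖x - y‖ ^ 2 := by gcongr
    nlinarith
  have hBxy := hB' k x hx y hy (hclose.trans_le (min_le_right _ _))
  have hAxy := hA' k x hx y hy (hclose.trans_le (min_le_left _ _))
  have hMle : M ≤ A k x - B k y := by
    have h1 := hmax k₀ z (subset_closure hz) z (subset_closure hz)
    have h2 : 0 ≤ α / 2 * ‖x - y‖ ^ 2 := by positivity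
    simp at h1
    linarith
  have hin : ∀ t ∈ closure Ω, t ∉ frontier Ω → t ∈ Ω := fun t ht hf => by
    by_contra h
    exact hf (hΩ.frontier_eq ▸ ⟨ht, h⟩)
  refine ⟨?_, hin x hx fun hf => ?_, hin y hy fun hf => ?_, hMle⟩
  · have := hBxy.trans_le (min_le_right _ _)
    linarith
  · have := abs_lt.1 (hBxy.trans_le (min_le_left _ _))
    rw [hB0 k x hf] at this
    rw [hA0 k x hf] at hMle
    linarith
  · have := abs_lt.1 hAxy
    rw [hA0 k y hf] at this
    rw [hB0 k y hf] at hMle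
    linarith

end Doubling

end Auxiliary

/-- Uniqueness for the Dirichlet problem: under degenerate ellipticity,
balanced quasi-monotonicity and conditions (i) and (ii), two continuous solutions of the
system in Ω that both vanish on ∂Ω coincide in Ω. -/
theorem dirichlet_uniqueness {n m₁ m₂ : ℕ} (hm₁ : 1 ≤ m₁)
    (Ω : Set (En n)) (hΩo : IsOpen Ω) (hΩb : IsBounded Ω)
    (F1 : Fin m₁ → Op n m₁ m₂) (F2 : Fin m₂ → Op n m₁ m₂)
    (hF1c : ∀ j, OpContinuousOn Ω (F1 j)) (hF2c : ∀ j, OpContinuousOn Ω (F2 j))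
    (hF1e : ∀ j, DegElliptic Ω (F1 j)) (hF2e : ∀ j, DegElliptic Ω (F2 j))
    (hQM : BalancedQM Ω F1 F2)
    -- condition (i): for ξ = (r,s), η = (ρ,σ) with ξ ≠ η, if the coordinate j realizes
    -- ξ_j - η_j = max_k |ξ_k - η_k| then F_j(x,ξ,p,X) - F_j(x,η,p,X) ≥ λ (ξ_j - η_j)
    (hi : ∃ lam : ℝ, 0 < lam ∧ ∀ x ∈ Ω, ∀ (p : En n) (X : Symn n), X.IsSymm →
      ∀ (r ρ : Fin m₁ → ℝ) (s σ : Fin m₂ → ℝ), (r, s) ≠ (ρ, σ) →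
        (∀ j, (∀ k, |r k - ρ k| ≤ r j - ρ j) → (∀ k, |s k - σ k| ≤ r j - ρ j) →
          lam * (r j - ρ j) ≤ F1 j x r s p X - F1 j x ρ σ p X) ∧
        (∀ j, (∀ k, |r k - ρ k| ≤ s j - σ j) → (∀ k, |s k - σ k| ≤ s j - σ j) →
          lam * (s j - σ j) ≤ F2 j x r s p X - F2 j x ρ σ p X))
    -- condition (ii)
    (hii : ∃ ω : ℝ → ℝ, Continuous ω ∧ ω 0 = 0 ∧ (∀ t, 0 ≤ t → 0 ≤ ω t) ∧
      ∀ (X Y : Symn n), X.IsSymm → Y.IsSymm → ∀ α : ℝ, 0 < α →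
        LoewnerLE ((-(3 * α)) • (1 : Matrix (Fin n ⊕ Fin n) (Fin n ⊕ Fin n) ℝ))
          (Matrix.fromBlocks X 0 0 Y) →
        LoewnerLE (Matrix.fromBlocks X 0 0 Y)
          ((3 * α) • Matrix.fromBlocks 1 (-1) (-1) (1 : Symn n)) →
        ∀ x ∈ Ω, ∀ y ∈ Ω, ∀ (r : Fin m₁ → ℝ) (s : Fin m₂ → ℝ),
          (∀ j, F1 j y r s (α • (x - y)) (-Y) - F1 j x r s (α • (x - y)) X ≤
            ω (α * ‖x - y‖ ^ 2 + 1 / α)) ∧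
          (∀ j, F2 j y r s (α • (x - y)) (-Y) - F2 j x r s (α • (x - y)) X ≤
            ω (α * ‖x - y‖ ^ 2 + 1 / α)))
    (u1 v1 : En n → Fin m₁ → ℝ) (u2 v2 : En n → Fin m₂ → ℝ)
    (huc1 : ContinuousOn u1 (closure Ω)) (huc2 : ContinuousOn u2 (closure Ω))
    (hvc1 : ContinuousOn v1 (closure Ω)) (hvc2 : ContinuousOn v2 (closure Ω))
    (husol : SuperSub Ω F1 F2 u1 u2 ∧ SubSuper Ω F1 F2 u1 u2)
    (hvsol : SuperSub Ω F1 F2 v1 v2 ∧ SubSuper Ω F1 F2 v1 v2)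
    (hu0 : ∀ x ∈ frontier Ω, u1 x = 0 ∧ u2 x = 0)
    (hv0 : ∀ x ∈ frontier Ω, v1 x = 0 ∧ v2 x = 0) :
    ∀ x ∈ Ω, u1 x = v1 x ∧ u2 x = v2 x := by
  obtain ⟨lam, hlam, hi⟩ := hi
  obtain ⟨ω, hωc, hω0, -, hii⟩ := hii
  set w₁ : Bool → En n → Fin m₁ → ℝ := fun b => cond b u1 v1
  set w₂ : Bool → En n → Fin m₂ → ℝ := fun b => cond b u2 v2
  have hc₁ : ∀ b, ContinuousOn (w₁ b) (closure Ω) := by rintro (_ | _) <;> assumption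
  have hc₂ : ∀ b, ContinuousOn (w₂ b) (closure Ω) := by rintro (_ | _) <;> assumption
  have hc₁' : ∀ b, ContinuousOn (w₁ b) Ω := fun b => (hc₁ b).mono subset_closure
  have hc₂' : ∀ b, ContinuousOn (w₂ b) Ω := fun b => (hc₂ b).mono subset_closure
  have hsol : ∀ b, SuperSub Ω F1 F2 (w₁ b) (w₂ b) ∧ SubSuper Ω F1 F2 (w₁ b) (w₂ b) := by
    rintro (_ | _) <;> assumption
  have hw0 : ∀ b, ∀ x ∈ frontier Ω, w₁ b x = 0 ∧ w₂ b x = 0 := by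
    rintro (_ | _) <;> assumption
  set A : (Fin m₁ ⊕ Fin m₂) × Bool → En n → ℝ := fun k x => Sum.elim (w₁ k.2 x) (w₂ k.2 x) k.1
  set B : (Fin m₁ ⊕ Fin m₂) × Bool → En n → ℝ := fun k => A (k.1, !k.2)
  have hA : ∀ k, ContinuousOn (A k) (closure Ω) := by
    rintro ⟨j | j, b⟩
    · exact (continuous_apply j).comp_continuousOn (hc₁ b)
    · exact (continuous_apply j).comp_continuousOn (hc₂ b)
  have hA0 : ∀ k, ∀ x ∈ frontier Ω, A k x = 0 := by
    rintro ⟨j | j, b⟩ x hx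
    · simp [A, (hw0 b x hx).1]
    · simp [A, (hw0 b x hx).2]
  suffices h : ∀ k, ∀ x ∈ Ω, A k x ≤ B k x from fun x hx =>
    ⟨funext fun j => le_antisymm (h (.inl j, true) x hx) (h (.inl j, false) x hx),
      funext fun j => le_antisymm (h (.inr j, true) x hx) (h (.inr j, false) x hx)⟩
  by_contra! hcon
  obtain ⟨k₀, z, hz, hlt⟩ := hcon
  have hM : 0 < A k₀ z - B k₀ z := sub_pos.2 hlt
  set M := A k₀ z - B k₀ z
  obtain ⟨δ, hδ, hωδ⟩ := Metric.continuousAt_iff.1 (hωc.continuousAt (x := 0)) (lam * M)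
    (mul_pos hlam hM)
  have hK : IsCompact (closure Ω) := hΩb.isCompact_closure
  obtain ⟨α₀, hα₀⟩ := exists_threshold_doubled_max hΩo hK hA (fun k => hA (k.1, !k.2)) hA0
    (fun k => hA0 (k.1, !k.2)) hM (η := δ / 3) (by positivity) hz le_rfl
  set α := max α₀ (3 / δ)
  have hα : 0 < α := lt_max_of_lt_right (by positivity)
  have : Nonempty ((Fin m₁ ⊕ Fin m₂) × Bool) := ⟨k₀⟩
  obtain ⟨⟨k, b⟩, x, hx, y, hy, hmax⟩ :=
    exists_doubled_max hK ⟨z, subset_closure hz⟩ hA (fun k => hA (k.1, !k.2)) α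
  obtain ⟨hpen, hxΩ, hyΩ, hMle⟩ := hα₀ α (le_max_left _ _) (k, b) x hx y hy hmax
  have habs : ∀ i, |A (i, b) x - A (i, !b) y| ≤ A (k, b) x - A (k, !b) y := fun i => by
    have h1 := hmax (i, b) x hx y hy
    have h2 := hmax (i, !b) y hy x hx
    rw [norm_sub_rev y x] at h2
    simp only [Bool.not_not] at h1 h2
    rw [abs_le]
    constructor <;> linarith
  have hsmall : ω (α * ‖x - y‖ ^ 2 + 1 / α) < lam * M := by
    have h1 : 1 / α ≤ δ / 3 := by
      rw [one_div_le hα (by positivity), one_div_div]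
      exact le_max_right _ _
    have h2 : 0 < 1 / α := by positivity
    have h3 : 0 ≤ α * ‖x - y‖ ^ 2 := by positivity
    have h4 := hωδ (x := α * ‖x - y‖ ^ 2 + 1 / α) (by
      rw [Real.dist_eq, sub_zero, abs_of_pos (by linarith)]
      linarith)
    rw [hω0, Real.dist_eq, sub_zero] at h4
    exact (le_abs_self _).trans_lt h4
  have hne : (w₁ b x, w₂ b x) ≠ (w₁ (!b) y, w₂ (!b) y) := fun he => by
    have h1 : A (k, b) x = A (k, !b) y := by
      rw [Prod.mk.injEq] at he
      simp only [A, he.1, he.2]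
    have h2 : M ≤ A (k, b) x - A (k, !b) y := hMle
    linarith
  have hmax' : ∀ x' ∈ closure Ω, ∀ y' ∈ closure Ω, A (k, b) x' - A (k, !b) y' -
      α / 2 * ‖x' - y'‖ ^ 2 ≤ A (k, b) x - A (k, !b) y - α / 2 * ‖x - y‖ ^ 2 := hmax (k, b)
  have hkey : lam * (A (k, b) x - A (k, !b) y) ≤ ω (α * ‖x - y‖ ^ 2 + 1 / α) := by
    rcases k with j | j
    · obtain ⟨X, Y, hX, hY, hl, hr, hle, hge⟩ :=
        (isComponentSolution_fst (hc₁' b) (hc₂' b) (hsol b).1 (hsol b).2 j).exists_matrices hΩo hΩb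
          (hF1c j) (hc₁' b) (hc₂' b) (hc₁' !b) (hc₂' !b) (hA (.inl j, b)) (hA (.inl j, !b))
          (isComponentSolution_fst (hc₁' !b) (hc₂' !b) (hsol !b).1 (hsol !b).2 j) hxΩ hyΩ hα hmax'
      have h1 := (hi y hyΩ (α • (x - y)) (-Y) hY.neg _ _ _ _ hne).1 j
        (fun i => habs (.inl i)) fun i => habs (.inr i)
      have h2 := (hii X Y hX hY α hα hl hr x hxΩ y hyΩ (w₁ b x) (w₂ b x)).1 j
      refine h1.trans ?_
      linarith
    · obtain ⟨X, Y, hX, hY, hl, hr, hle, hge⟩ :=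
        (isComponentSolution_snd (hc₁' b) (hc₂' b) (hsol b).1 (hsol b).2 j).exists_matrices hΩo hΩb
          (hF2c j) (hc₁' b) (hc₂' b) (hc₁' !b) (hc₂' !b) (hA (.inr j, b)) (hA (.inr j, !b))
          (isComponentSolution_snd (hc₁' !b) (hc₂' !b) (hsol !b).1 (hsol !b).2 j) hxΩ hyΩ hα hmax'
      have h1 := (hi y hyΩ (α • (x - y)) (-Y) hY.neg _ _ _ _ hne).2 j
        (fun i => habs (.inl i)) fun i => habs (.inr i)
      have h2 := (hii X Y hX hY α hα hl hr x hxΩ y hyΩ (w₁ b x) (w₂ b x)).2 j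
      refine h1.trans ?_
      linarith
  have : lam * M ≤ lam * (A (k, b) x - A (k, !b) y) := mul_le_mul_of_nonneg_left hMle hlam.le
  linarith
end
end
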